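/- arXiv:1210.0523 — 7 statements merged into one kernel-verified Lean document; each statement's English description precedes it below -/
import Mathlib

section
/- Let R and T be the above 4×4 integer matrices with d = 5 and k = 5. Then R^5 = I, and the group homomorphism from the free product ℤ ∗ ℤ/5ℤ to GL(4, ℤ) sending the generator of ℤ to T and the generator of ℤ/5ℤ to R is injective; in particular, the subgroup of GL(4, ℤ) generated by R and T is isomorphic to ℤ ∗ ℤ/5ℤ. -/
open scoped MatrixGroups

open scoped Pointwise

universe u

/-- Ping-pong lemma for the free product of two groups, one of which has at least three elements. -/
theorem Monoid.Coprod.injective_of_ping_pong {M N : Type u} {G α : Type*} [Group M] [Group N]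
    [Group G] [MulAction G α] (φ : Monoid.Coprod M N →* G) (hcard : 3 ≤ Cardinal.mk N)
    {X Y : Set α} (hX : X.Nonempty) (hY : Y.Nonempty) (hXY : Disjoint X Y)
    (hM : ∀ m : M, m ≠ 1 → ∀ y ∈ Y, φ (Monoid.Coprod.inl m) • y ∈ X)
    (hN : ∀ n : N, n ≠ 1 → ∀ x ∈ X, φ (Monoid.Coprod.inr n) • x ∈ Y) :
    Function.Injective φ := by
  let H : Bool → Type u := fun b => cond b M N
  let instH : ∀ b, Group (H b) := fun b => match b with
    | true => ‹Group M›
    | false => ‹Group N›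
  let f : ∀ b, H b →* G := fun b => match b with
    | true => φ.comp Monoid.Coprod.inl
    | false => φ.comp Monoid.Coprod.inr
  let ι : ∀ b, H b →* Monoid.Coprod M N := fun b => match b with
    | true => Monoid.Coprod.inl
    | false => Monoid.Coprod.inr
  let ψ : Monoid.Coprod M N →* Monoid.CoprodI H :=
    Monoid.Coprod.lift (Monoid.CoprodI.of (M := H) (i := true))
      (Monoid.CoprodI.of (M := H) (i := false))
  have hι : (Monoid.CoprodI.lift ι).comp ψ = MonoidHom.id _ := by
    ext x
    · exact Monoid.CoprodI.lift_of ι (i := true) x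
    · exact Monoid.CoprodI.lift_of ι (i := false) x
  have hφ : φ = (Monoid.CoprodI.lift f).comp ψ := by
    ext x
    · exact (Monoid.CoprodI.lift_of f (i := true) x).symm
    · exact (Monoid.CoprodI.lift_of f (i := false) x).symm
  have hψ : Function.Injective ψ :=
    Function.LeftInverse.injective (g := Monoid.CoprodI.lift ι) (DFunLike.congr_fun hι)
  rw [hφ, MonoidHom.coe_comp]
  refine Function.Injective.comp (Monoid.CoprodI.lift_injective_of_ping_pong f
    (Or.inr ⟨false, hcard⟩) (fun b => cond b X Y) ?_ ?_ ?_) hψ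
  · rintro (_ | _)
    exacts [hY, hX]
  · rintro (_ | _) (_ | _) h
    exacts [(h rfl).elim, hXY.symm, hXY, (h rfl).elim]
  · rintro (_ | _) (_ | _) h
    · exact (h rfl).elim
    · rintro n hn _ ⟨x, hx, rfl⟩
      exact hN n hn x hx
    · rintro m hm _ ⟨y, hy, rfl⟩
      exact hM m hm y hy
    · exact (h rfl).elim

namespace QuinticMonodromy

/-- The open simplicial cone on which the inverse powers of the transvection play. -/
def negCone : Set (Fin 4 → ℤ) :=
  {x | 0 < x 0 ∧ 0 < x 1 ∧ 0 < 5 * (x 1 - x 0) + 2 * x 2 ∧ 5 * x 0 + 3 * x 3 < 0}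

/-- The open simplicial cone on which the positive powers of the transvection play. -/
def posCone : Set (Fin 4 → ℤ) :=
  {x | x 0 < 0 ∧ x 3 < x 1 ∧ 0 < 5 * (x 1 - x 0 - x 3) + 2 * x 2 ∧ 0 < 5 * x 0 + 3 * x 3}

/-- The union of the two ping-pong cones and of their negatives. -/
def cones : Set (Fin 4 → ℤ) :=
  (negCone ∪ -negCone) ∪ (posCone ∪ -posCone)

/-- The rotation `R`, of order five. -/
def rotation : Matrix (Fin 4) (Fin 4) ℤ :=
  !![1, 1, 0, 0; 0, -4, -1, 1; 5, 5, 1, 0; 0, -5, -1, 1]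

/-- The powers of the transvection `T`. -/
def transvection (n : ℤ) : Matrix (Fin 4) (Fin 4) ℤ :=
  !![1, 0, 0, 0; 0, 1, 0, n; 0, 0, 1, 0; 0, 0, 0, 1]

theorem rotation_pow_two :
    rotation ^ 2 = !![1, -3, -1, 1; -5, 6, 2, -3; 10, -10, -4, 5; -5, 10, 3, -4] := by
  decide

theorem rotation_pow_three :
    rotation ^ 3 = !![-4, 3, 1, -2; 5, -4, -1, 3; -10, 5, 1, -5; 10, -10, -3, 6] := by
  decide

theorem rotation_pow_four :
    rotation ^ 4 = !![1, -1, 0, 1; 0, 1, 0, -1; -5, 0, 1, 0; -5, 5, 1, -4] := by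
  decide

theorem rotation_pow_five : rotation ^ 5 = 1 := by
  decide

/-- The two ping-pong conditions up to sign, and the disjointness of the ping-pong sets. -/
theorem mulVec_rotation_pow {k : ℕ} (h0 : k ≠ 0) (h5 : k < 5) {x : Fin 4 → ℤ} (hx : x ∈ cones) :
    (transvection 1 * rotation ^ k).mulVec x ∈ posCone ∪ -posCone ∧
      (transvection (-1) * rotation ^ k).mulVec x ∈ negCone ∪ -negCone ∧
      (rotation ^ k).mulVec x ∉ cones := by
  have hk : k = 1 ∨ k = 2 ∨ k = 3 ∨ k = 4 := by omega
  simp only [cones, negCone, posCone, ← Matrix.mulVec_mulVec, Set.mem_union, Set.mem_neg,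
    Set.mem_ofPred_eq, Pi.neg_apply] at hx ⊢
  rcases hk with rfl | rfl | rfl | rfl
  all_goals
    simp only [pow_one, rotation_pow_two, rotation_pow_three, rotation_pow_four]
    simp only [rotation, transvection, Matrix.mulVec, dotProduct,
      Fin.sum_univ_four, Matrix.of_apply, Matrix.cons_val]
    rcases hx with (⟨h1, h2, h3, h4⟩ | ⟨h1, h2, h3, h4⟩) | ⟨h1, h2, h3, h4⟩ | ⟨h1, h2, h3, h4⟩
  all_goals
    refine ⟨?_, ?_, ?_⟩
    · first
        | exact Or.inl ⟨by linarith, by linarith, by linarith, by linarith⟩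
        | exact Or.inr ⟨by linarith, by linarith, by linarith, by linarith⟩
    · first
        | exact Or.inl ⟨by linarith, by linarith, by linarith, by linarith⟩
        | exact Or.inr ⟨by linarith, by linarith, by linarith, by linarith⟩
    · rintro ((⟨g1, g2, g3, g4⟩ | ⟨g1, g2, g3, g4⟩) | ⟨g1, g2, g3, g4⟩ | ⟨g1, g2, g3, g4⟩) <;>
        linarith

theorem transvection_mul (m n : ℤ) :
    transvection m * transvection n = transvection (m + n) := by
  ext i j
  fin_cases i <;> fin_cases j <;>
    simp [transvection, Matrix.mul_apply, Fin.sum_univ_four, add_comm]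

theorem transvection_zero : transvection 0 = 1 := by
  decide

theorem transvection_mulVec_mem_posCone {n : ℤ} (hn : 1 ≤ n) {x : Fin 4 → ℤ}
    (hx : (transvection 1).mulVec x ∈ posCone) : (transvection n).mulVec x ∈ posCone := by
  simp only [posCone, transvection, Matrix.mulVec, dotProduct, Fin.sum_univ_four, Matrix.of_apply,
    Matrix.cons_val, Set.mem_ofPred_eq] at hx ⊢
  obtain ⟨h1, h2, h3, h4⟩ := hx
  have h5 : 0 < x 3 := by linarith
  have h6 : 0 ≤ (n - 1) * x 3 := mul_nonneg (by linarith) h5.le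
  exact ⟨by linarith, by linarith, by linarith, by linarith⟩

theorem transvection_mulVec_mem_negCone {n : ℤ} (hn : n ≤ -1) {x : Fin 4 → ℤ}
    (hx : (transvection (-1)).mulVec x ∈ negCone) : (transvection n).mulVec x ∈ negCone := by
  simp only [negCone, transvection, Matrix.mulVec, dotProduct, Fin.sum_univ_four, Matrix.of_apply,
    Matrix.cons_val, Set.mem_ofPred_eq] at hx ⊢
  obtain ⟨h1, h2, h3, h4⟩ := hx
  have h5 : x 3 < 0 := by linarith
  have h6 : 0 ≤ (n + 1) * x 3 := mul_nonneg_of_nonpos_of_nonpos (by linarith) h5.le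
  exact ⟨by linarith, by linarith, by linarith, by linarith⟩

theorem transvection_mulVec_rotation_pow_mem_cones {n : ℤ} (hn : n ≠ 0) {k : ℕ} (h0 : k ≠ 0)
    (h5 : k < 5) {x : Fin 4 → ℤ} (hx : x ∈ cones) :
    (transvection n).mulVec ((rotation ^ k).mulVec x) ∈ cones := by
  obtain ⟨hpos, hneg, -⟩ := mulVec_rotation_pow h0 h5 hx
  simp only [← Matrix.mulVec_mulVec, Set.mem_union, Set.mem_neg, ← Matrix.mulVec_neg] at hpos hneg
  simp only [cones, Set.mem_union, Set.mem_neg, ← Matrix.mulVec_neg]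
  rcases hn.lt_or_gt with hn | hn
  · exact Or.inl (hneg.imp (transvection_mulVec_mem_negCone (by omega))
      (transvection_mulVec_mem_negCone (by omega)))
  · exact Or.inr (hpos.imp (transvection_mulVec_mem_posCone (by omega))
      (transvection_mulVec_mem_posCone (by omega)))

theorem coe_zpow_transvection {T : GL (Fin 4) ℤ}
    (hT : (T : Matrix (Fin 4) (Fin 4) ℤ) = transvection 1) (n : ℤ) :
    ((T ^ n : GL (Fin 4) ℤ) : Matrix (Fin 4) (Fin 4) ℤ) = transvection n := by
  let t : Multiplicative ℤ →* Matrix (Fin 4) (Fin 4) ℤ :=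
    { toFun := fun m => transvection m.toAdd
      map_one' := transvection_zero
      map_mul' := fun a b => (transvection_mul a.toAdd b.toAdd).symm }
  have h : T = t.toHomUnits (Multiplicative.ofAdd 1) := Units.ext hT
  rw [h, ← map_zpow, ← ofAdd_zsmul, smul_eq_mul, mul_one]
  rfl

theorem ofAdd_one_pow_val {m : ℕ} [NeZero m] (n : Multiplicative (ZMod m)) :
    Multiplicative.ofAdd (1 : ZMod m) ^ n.toAdd.val = n := by
  rw [← ofAdd_nsmul, nsmul_one, ZMod.natCast_zmod_val, ofAdd_toAdd]

/-- Ping-pong between the powers of `T`, which play on `cones`, and those of `R`, which play on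
the proper rotates of `cones`. -/
theorem injective_of_generators {R T : GL (Fin 4) ℤ}
    (hR : (R : Matrix (Fin 4) (Fin 4) ℤ) = rotation)
    (hT : (T : Matrix (Fin 4) (Fin 4) ℤ) = transvection 1)
    (φ : Monoid.Coprod (Multiplicative ℤ) (Multiplicative (ZMod 5)) →* GL (Fin 4) ℤ)
    (hφT : φ (Monoid.Coprod.inl (Multiplicative.ofAdd (1 : ℤ))) = T)
    (hφR : φ (Monoid.Coprod.inr (Multiplicative.ofAdd (1 : ZMod 5))) = R) :
    Function.Injective φ := by
  let _ : MulAction (GL (Fin 4) ℤ) (Fin 4 → ℤ) :=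
    { smul := fun g x => (g : Matrix (Fin 4) (Fin 4) ℤ).mulVec x
      one_smul := Matrix.one_mulVec
      mul_smul := fun g h x => (Matrix.mulVec_mulVec x _ _).symm }
  have hinl (m : Multiplicative ℤ) :
      (φ (Monoid.Coprod.inl m) : Matrix (Fin 4) (Fin 4) ℤ) = transvection m.toAdd := by
    rw [← coe_zpow_transvection hT, ← hφT, ← map_zpow, ← map_zpow, ← ofAdd_zsmul, smul_eq_mul,
      mul_one, ofAdd_toAdd]
  have hinr (n : Multiplicative (ZMod 5)) :
      (φ (Monoid.Coprod.inr n) : Matrix (Fin 4) (Fin 4) ℤ) = rotation ^ n.toAdd.val := by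
    rw [← hR, ← Units.val_pow_eq_pow_val, ← hφR, ← map_pow, ← map_pow, ofAdd_one_pow_val]
  have hbase : ![1, 1, 1, -2] ∈ cones :=
    Or.inl (Or.inl ⟨by decide, by decide, by decide, by decide⟩)
  refine Monoid.Coprod.injective_of_ping_pong φ ?_ (X := cones)
    (Y := {y | ∃ k : ℕ, k ≠ 0 ∧ k < 5 ∧ ∃ x ∈ cones, (rotation ^ k).mulVec x = y})
    ⟨_, hbase⟩ ⟨_, 1, one_ne_zero, by norm_num, _, hbase, rfl⟩ ?_ ?_ ?_
  · rw [← Nat.cast_ofNat, Cardinal.mk_fintype, Fintype.card_multiplicative, ZMod.card]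
    norm_num
  · rw [Set.disjoint_right]
    rintro _ ⟨k, h0, h5, x, hx, rfl⟩
    exact (mulVec_rotation_pow h0 h5 hx).2.2
  · rintro m hm _ ⟨k, h0, h5, x, hx, rfl⟩
    change Matrix.mulVec _ _ ∈ cones
    rw [hinl]
    exact transvection_mulVec_rotation_pow_mem_cones (by simpa using hm) h0 h5 hx
  · intro n hn x hx
    refine ⟨n.toAdd.val, by simpa using hn, ZMod.val_lt _, x, hx, ?_⟩
    rw [← hinr]
    rfl

end QuinticMonodromy

/-- For `d = 5`, `k = 5`, the hypergeometric matrices `R = T·U` and `T`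
satisfy `R^5 = 1`, the homomorphism `ℤ ∗ ℤ/5ℤ →* GL(4,ℤ)` sending the generator of `ℤ`
to `T` and the generator of `ℤ/5ℤ` to `R` is injective, and consequently the subgroup of
`GL(4,ℤ)` generated by `R` and `T` is isomorphic to `ℤ ∗ ℤ/5ℤ`. -/
theorem quintic_monodromy_splits_as_Z_free_prod_Z5
    (R T : GL (Fin 4) ℤ)
    (hR : (R : Matrix (Fin 4) (Fin 4) ℤ) =
      !![1, 1, 0, 0; 0, -4, -1, 1; 5, 5, 1, 0; 0, -5, -1, 1])
    (hT : (T : Matrix (Fin 4) (Fin 4) ℤ) =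
      !![1, 0, 0, 0; 0, 1, 0, 1; 0, 0, 1, 0; 0, 0, 0, 1]) :
    R ^ 5 = 1 ∧
    (∀ φ : Monoid.Coprod (Multiplicative ℤ) (Multiplicative (ZMod 5)) →* GL (Fin 4) ℤ,
        φ (Monoid.Coprod.inl (Multiplicative.ofAdd (1 : ℤ))) = T →
        φ (Monoid.Coprod.inr (Multiplicative.ofAdd (1 : ZMod 5))) = R →
        Function.Injective φ) ∧
    Nonempty (Monoid.Coprod (Multiplicative ℤ) (Multiplicative (ZMod 5)) ≃*
      (Subgroup.closure ({R, T} : Set (GL (Fin 4) ℤ)))) := by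
  have hR5 : R ^ 5 = 1 := Units.ext <| by
    rw [Units.val_pow_eq_pow_val, hR]
    exact QuinticMonodromy.rotation_pow_five
  refine ⟨hR5, QuinticMonodromy.injective_of_generators hR hT, ?_⟩
  let z : {f : ℤ →+ Additive (GL (Fin 4) ℤ) // f (5 : ℕ) = 0} :=
    ⟨zmultiplesHom _ (Additive.ofMul R), by
      rw [zmultiplesHom_apply, natCast_zsmul, ← ofMul_pow, hR5, ofMul_one]⟩
  let r : Multiplicative (ZMod 5) →* GL (Fin 4) ℤ :=
    AddMonoidHom.toMultiplicativeLeft (ZMod.lift 5 z)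
  have hr : r (Multiplicative.ofAdd 1) = R := by
    have h : ZMod.lift 5 z 1 = Additive.ofMul R := by simpa [z] using ZMod.lift_coe 5 z 1
    exact congrArg Additive.toMul h
  let φ := Monoid.Coprod.lift (zpowersHom _ T) r
  have hφT : φ (Monoid.Coprod.inl (Multiplicative.ofAdd (1 : ℤ))) = T := by simp [φ]
  have hφR : φ (Monoid.Coprod.inr (Multiplicative.ofAdd (1 : ZMod 5))) = R := by simp [φ, hr]
  have hrange : φ.range = Subgroup.closure {R, T} := by
    apply le_antisymm
    · rw [Monoid.Coprod.range_lift, Subgroup.range_zpowersHom, sup_le_iff, Subgroup.zpowers_le]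
      refine ⟨Subgroup.subset_closure (by simp), ?_⟩
      rintro _ ⟨n, rfl⟩
      rw [← QuinticMonodromy.ofAdd_one_pow_val n, map_pow, hr]
      exact pow_mem (Subgroup.subset_closure (by simp)) _
    · rw [Subgroup.closure_le, Set.insert_subset_iff, Set.singleton_subset_iff]
      exact ⟨⟨_, hφR⟩, ⟨_, hφT⟩⟩
  exact ⟨(MonoidHom.ofInjective
    (QuinticMonodromy.injective_of_generators hR hT φ hφT hφR)).trans
      (MulEquiv.subgroupCongr hrange)⟩
end

section
/- Let R and T be the above 4×4 integer matrices with d = 2 and k = 4. Then R^4 = -I (so R has order 8, and -I lies in both the subgroup generated by {T, -I} and the subgroup generated by R), and the group homomorphism from the amalgamated free product (ℤ × ℤ/2ℤ) ∗_{ℤ/2ℤ} ℤ/8ℤ — the pushout of the homomorphisms ℤ/2ℤ → ℤ × ℤ/2ℤ sending 1 ↦ (0,1) and ℤ/2ℤ → ℤ/8ℤ sending 1 ↦ 4 — to GL(4, ℤ) determined by (1,0) ↦ T, (0,1) ↦ -I, and the generator of ℤ/8ℤ ↦ R, is injective; in particular the subgroup of GL(4, ℤ) generated by R and T is isomorphic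 to (ℤ × ℤ/2ℤ) ∗_{ℤ/2ℤ} ℤ/8ℤ. -/
open scoped MatrixGroups

/-- The two factors of the amalgamated product `(ℤ × ℤ/2ℤ) ∗_{ℤ/2ℤ} ℤ/8ℤ`:
the factor at `true` is `ℤ × ℤ/2ℤ` and the factor at `false` is `ℤ/8ℤ`
(written multiplicatively). -/
def AmalgFactor8 : Bool → Type :=
  fun b => match b with
  | true => Multiplicative (ℤ × ZMod 2)
  | false => Multiplicative (ZMod 8)

instance : ∀ b, Group (AmalgFactor8 b) :=
  fun b => match b with
  | true => inferInstanceAs (Group (Multiplicative (ℤ × ZMod 2)))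
  | false => inferInstanceAs (Group (Multiplicative (ZMod 8)))

/-- The map `ℤ/2ℤ → ℤ × ℤ/2ℤ` sending `1 ↦ (0,1)` (written multiplicatively). -/
def incl8₁ : Multiplicative (ZMod 2) →* Multiplicative (ℤ × ZMod 2) :=
  AddMonoidHom.toMultiplicative ((0 : ZMod 2 →+ ℤ).prod (AddMonoidHom.id (ZMod 2)))

/-- The map `ℤ/2ℤ → ℤ/8ℤ` sending `1 ↦ 4` (written multiplicatively). -/
def incl8₂ : Multiplicative (ZMod 2) →* Multiplicative (ZMod 8) :=
  AddMonoidHom.toMultiplicative (ZMod.lift 2 ⟨zmultiplesHom (ZMod 8) 4, by decide⟩)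

/-- The pair of maps defining the pushout `(ℤ × ℤ/2ℤ) ∗_{ℤ/2ℤ} ℤ/8ℤ`. -/
def amalgMaps8 : ∀ b, Multiplicative (ZMod 2) →* AmalgFactor8 b :=
  fun b => match b with
  | true => incl8₁
  | false => incl8₂

/-- Ping-pong for amalgamated products: if `X i` is stable under the base group, contains the image
of `p` under every letter from the factor `i` and the image of `X j` for `j ≠ i` under such letters,
and `p ∉ X i`, then only elements of the base group can fix `p`. -/
theorem Monoid.PushoutI.eq_one_of_smul_eq_of_ping_pong {ι : Type*} {G : ι → Type*} {H α : Type*}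
    [∀ i, Group (G i)] [Group H] {φ : ∀ i, H →* G i} [MulAction (Monoid.PushoutI φ) α]
    (X : ι → Set α) (p : α)
    (hbase : ∀ h : H, base φ h • p = p → h = 1)
    (hbaseX : ∀ i (h : H), ∀ x ∈ X i, base φ h • x ∈ X i)
    (hp : ∀ i (g : G i), g ∉ (φ i).range → of (φ := φ) i g • p ∈ X i)
    (hX : ∀ i j (g : G i), i ≠ j → g ∉ (φ i).range → ∀ x ∈ X j, of (φ := φ) i g • x ∈ X i)
    (hpX : ∀ i, p ∉ X i) (g : Monoid.PushoutI φ) (hg : g • p = p) : g = 1 := by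
  classical
  have hinj (i : ι) : Function.Injective (φ i) := by
    rw [injective_iff_map_eq_one]
    intro h hh
    refine hbase h ?_
    rw [← of_apply_eq_base φ i, hh, map_one, one_smul]
  obtain ⟨d⟩ := NormalWord.transversal_nonempty φ hinj
  have key (w : NormalWord d) : (w.fstIdx = none ∧ ∃ h, w.prod = base φ h) ∨
      ∃ i, w.fstIdx = some i ∧ w.prod • p ∈ X i := by
    induction w using NormalWord.consRecOn with
    | empty => exact Or.inl ⟨rfl, 1, by simp⟩
    | cons i g w hmw _ hgr _ ih =>
      refine Or.inr ⟨i, by simp [NormalWord.cons], ?_⟩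
      rw [NormalWord.prod_cons]
      rcases ih with ⟨-, h, hh⟩ | ⟨j, hj, hw⟩
      · rw [hh, ← of_apply_eq_base φ i, ← map_mul]
        exact hp i _ (mt (Subgroup.mul_mem_cancel_right _ (by simp)).1 hgr)
      · rw [mul_smul]
        exact hX i j g (fun hij => hmw (hij ▸ hj)) hgr _ hw
    | base h w _ ih =>
      rw [NormalWord.base_smul_eq_smul, NormalWord.prod_base_smul]
      rcases ih with ⟨hn, h', hh⟩ | ⟨i, hi, hw⟩
      · exact Or.inl ⟨hn, h * h', by rw [hh, map_mul]⟩
      · exact Or.inr ⟨i, hi, by rw [mul_smul]; exact hbaseX i h _ hw⟩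
  have hgw : (NormalWord.equiv (d := d) g).prod = g := NormalWord.equiv.symm_apply_apply g
  rcases key (NormalWord.equiv g) with ⟨-, h, hh⟩ | ⟨i, -, hi⟩
  · rw [hgw] at hh
    rw [hh] at hg ⊢
    rw [hbase h hg, map_one]
  · rw [hgw, hg] at hi
    exact absurd hi (hpX i)

namespace HypergeometricPingPong

/-- The action of `T ^ n` on column vectors. -/
def shear (n : ℤ) (v : Fin 4 → ℤ) : Fin 4 → ℤ := ![v 0, v 1 + n * v 3, v 2, v 3]

/-- The action of `R` on column vectors. -/
def rot (v : Fin 4 → ℤ) : Fin 4 → ℤ :=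
  ![v 0 + v 1, -3 * v 1 - v 2 + v 3, 2 * v 0 + 2 * v 1 + v 2, -4 * v 1 - v 2 + v 3]

/-- A polyhedral cone attracting positive powers of `T`. -/
def PosCone (v : Fin 4 → ℤ) : Prop :=
  v 0 ≤ 0 ∧ 0 ≤ -v 0 + v 1 + v 2 - v 3 ∧ 0 ≤ v 1 - v 3 ∧ 0 ≤ v 0 + v 2 + v 3 ∧
    0 ≤ 2 * v 0 + v 3 ∧ 0 ≤ 3 * v 0 + 5 * v 1 + 8 * v 2 - 2 * v 3 ∧
    0 ≤ 11 * v 0 + 5 * v 1 - 2 * v 3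

/-- A polyhedral cone attracting negative powers of `T`. -/
def NegCone (v : Fin 4 → ℤ) : Prop :=
  0 ≤ v 0 ∧ 0 ≤ -v 0 + v 1 + v 2 ∧ 0 ≤ v 1 ∧ 0 ≤ -3 * v 0 + v 2 - v 3 ∧
    0 ≤ -2 * v 0 - v 3 ∧ 0 ≤ -19 * v 0 + 5 * v 1 + 8 * v 2 - 3 * v 3 ∧
    0 ≤ -11 * v 0 + 5 * v 1 - 3 * v 3

/-- The union of the two cones and their negatives. -/
def InCones (v : Fin 4 → ℤ) : Prop :=
  (PosCone v ∨ PosCone (-v)) ∨ (NegCone v ∨ NegCone (-v))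

/-- The vectors sent into `±PosCone` by `T` and into `±NegCone` by `T⁻¹`. -/
def Attracted (v : Fin 4 → ℤ) : Prop :=
  (PosCone (shear 1 v) ∨ PosCone (-shear 1 v)) ∧ (NegCone (shear (-1) v) ∨ NegCone (-shear (-1) v))

/-- A vector outside the cones. -/
def basePoint : Fin 4 → ℤ := ![-1, 0, 0, 4]

theorem shear_add (m n : ℤ) (v : Fin 4 → ℤ) : shear (m + n) v = shear m (shear n v) := by
  ext i; fin_cases i <;> simp [shear]; ring

theorem shear_neg (n : ℤ) (v : Fin 4 → ℤ) : shear n (-v) = -shear n v := by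
  ext i; fin_cases i <;> simp [shear]; ring

theorem rot_neg (v : Fin 4 → ℤ) : rot (-v) = -rot v := by
  ext i; fin_cases i <;> simp [rot] <;> ring

theorem PosCone.shear_mem {v : Fin 4 → ℤ} (hv : PosCone v) {n : ℤ} (hn : 0 ≤ n) :
    PosCone (shear n v) := by
  have h3 : 0 ≤ v 3 := by unfold PosCone at hv; lia
  have := mul_nonneg hn h3
  simp only [PosCone, shear, Matrix.cons_val] at hv ⊢
  lia

theorem NegCone.shear_mem {v : Fin 4 → ℤ} (hv : NegCone v) {n : ℤ} (hn : n ≤ 0) :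
    NegCone (shear n v) := by
  have h3 : v 3 ≤ 0 := by unfold NegCone at hv; lia
  have := mul_nonneg_of_nonpos_of_nonpos hn h3
  simp only [NegCone, shear, Matrix.cons_val] at hv ⊢
  lia

theorem inCones_neg {v : Fin 4 → ℤ} : InCones (-v) ↔ InCones v := by
  simp only [InCones, neg_neg]; tauto

theorem attracted_neg {v : Fin 4 → ℤ} : Attracted (-v) ↔ Attracted v := by
  simp only [Attracted, shear_neg, neg_neg]; tauto

theorem Attracted.inCones_shear {v : Fin 4 → ℤ} (hv : Attracted v) {n : ℤ} (hn : n ≠ 0) :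
    InCones (shear n v) := by
  rcases lt_or_gt_of_ne hn with hn | hn
  · rw [show n = (n + 1) + -1 by ring, shear_add]
    refine Or.inr (hv.2.imp (fun h => h.shear_mem (by lia)) fun h => ?_)
    rw [← shear_neg]
    exact h.shear_mem (by lia)
  · rw [show n = (n - 1) + 1 by ring, shear_add]
    refine Or.inl (hv.1.imp (fun h => h.shear_mem (by lia)) fun h => ?_)
    rw [← shear_neg]
    exact h.shear_mem (by lia)

theorem PosCone.attracted_rot_iterate {v : Fin 4 → ℤ} (hv : PosCone v) {k : ℕ} (hk : 0 < k)
    (hk' : k < 4) : Attracted (rot^[k] v) := by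
  simp only [PosCone] at hv
  interval_cases k <;>
    simp only [Function.iterate_succ, Function.iterate_zero, Function.comp_apply, id_eq, Attracted,
      PosCone, NegCone, shear, rot, Matrix.cons_val, Pi.neg_apply] <;>
    constructor <;> first | (left; lia) | (right; lia)

theorem NegCone.attracted_rot_iterate {v : Fin 4 → ℤ} (hv : NegCone v) {k : ℕ} (hk : 0 < k)
    (hk' : k < 4) : Attracted (rot^[k] v) := by
  simp only [NegCone] at hv
  interval_cases k <;>
    simp only [Function.iterate_succ, Function.iterate_zero, Function.comp_apply, id_eq, Attracted,
      PosCone, NegCone, shear, rot, Matrix.cons_val, Pi.neg_apply] <;>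
    constructor <;> first | (left; lia) | (right; lia)

theorem rot_iterate_neg (k : ℕ) (v : Fin 4 → ℤ) : rot^[k] (-v) = -rot^[k] v := by
  induction k generalizing v with
  | zero => rfl
  | succ k ih => simp [rot_neg, ih]

theorem rot_iterate_four (v : Fin 4 → ℤ) : rot^[4] v = -v := by
  ext i; fin_cases i <;> simp [rot] <;> ring

theorem InCones.attracted_rot_iterate {v : Fin 4 → ℤ} (hv : InCones v) {k : ℕ} (hk : 0 < k)
    (hk' : k < 4) : Attracted (rot^[k] v) := by
  rcases hv with (hv | hv) | (hv | hv)
  · exact hv.attracted_rot_iterate hk hk'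
  · rw [← attracted_neg, ← rot_iterate_neg]
    exact hv.attracted_rot_iterate hk hk'
  · exact hv.attracted_rot_iterate hk hk'
  · rw [← attracted_neg, ← rot_iterate_neg]
    exact hv.attracted_rot_iterate hk hk'

instance : DecidablePred PosCone := fun _ => inferInstanceAs (Decidable (_ ∧ _))

instance : DecidablePred NegCone := fun _ => inferInstanceAs (Decidable (_ ∧ _))

instance : DecidablePred InCones := fun _ => inferInstanceAs (Decidable (_ ∨ _))

instance : DecidablePred Attracted := fun _ => inferInstanceAs (Decidable (_ ∧ _))

theorem attracted_rot_iterate_basePoint {k : ℕ} (hk : k < 4) :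
    Attracted (rot^[k] basePoint) := by
  interval_cases k <;> decide

theorem not_inCones_rot_iterate_basePoint {k : ℕ} (hk : k < 4) :
    ¬ InCones (rot^[k] basePoint) := by
  interval_cases k <;> decide

theorem rot_iterate_basePoint_ne {k : ℕ} (hk : 0 < k) (hk' : k < 4) :
    rot^[k] basePoint ≠ basePoint ∧ rot^[k] basePoint ≠ -basePoint := by
  interval_cases k <;> decide

/-- The ping-pong set for `⟨R⟩`. -/
def RotSet : Set (Fin 4 → ℤ) := {v | Attracted v ∧ v ≠ basePoint ∧ v ≠ -basePoint}

theorem neg_mem_rotSet {v : Fin 4 → ℤ} (hv : v ∈ RotSet) : -v ∈ RotSet :=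
  ⟨attracted_neg.2 hv.1, fun h => hv.2.2 (by rw [← h, neg_neg]), fun h => hv.2.1 (neg_inj.1 h)⟩

theorem rot_iterate_mem_rotSet {v : Fin 4 → ℤ} {k : ℕ} (hk : k ≠ 0 ∧ k ≠ 4) (hk' : k < 8)
    (h : ∀ j, 0 < j → j < 4 → rot^[j] v ∈ RotSet) : rot^[k] v ∈ RotSet := by
  rcases lt_or_ge k 4 with hk4 | hk4
  · exact h k (by lia) hk4
  · rw [← Nat.sub_add_cancel hk4, Function.iterate_add_apply, rot_iterate_four, rot_iterate_neg]
    exact neg_mem_rotSet (h _ (by lia) (by lia))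

theorem rot_iterate_basePoint_mem_rotSet {k : ℕ} (hk : 0 < k) (hk' : k < 4) :
    rot^[k] basePoint ∈ RotSet :=
  ⟨attracted_rot_iterate_basePoint hk', rot_iterate_basePoint_ne hk hk'⟩

theorem InCones.rot_iterate_mem_rotSet {v : Fin 4 → ℤ} (hv : InCones v) {k : ℕ} (hk : 0 < k)
    (hk' : k < 4) : rot^[k] v ∈ RotSet := by
  have hback : InCones (rot^[4 - k] (rot^[k] v)) := by
    rw [← Function.iterate_add_apply, Nat.sub_add_cancel hk'.le, rot_iterate_four]
    exact inCones_neg.2 hv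
  have hnot := not_inCones_rot_iterate_basePoint (k := 4 - k) (by lia)
  refine ⟨hv.attracted_rot_iterate hk hk', fun h => hnot (h ▸ hback), fun h => hnot ?_⟩
  rw [h, rot_iterate_neg, inCones_neg] at hback
  exact hback

theorem mulVec_zpow (T : GL (Fin 4) ℤ)
    (hT : (T : Matrix (Fin 4) (Fin 4) ℤ) =
      !![1, 0, 0, 0; 0, 1, 0, 1; 0, 0, 1, 0; 0, 0, 0, 1]) (n : ℤ) (v : Fin 4 → ℤ) :
    ((T ^ n : GL (Fin 4) ℤ) : Matrix (Fin 4) (Fin 4) ℤ).mulVec v = shear n v := by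
  have h1 (v : Fin 4 → ℤ) : (T : Matrix (Fin 4) (Fin 4) ℤ).mulVec v = shear 1 v := by
    ext i
    fin_cases i <;> simp [hT, shear, Matrix.mulVec, dotProduct, Fin.sum_univ_four]
  have h0 (v : Fin 4 → ℤ) : shear 0 v = v := by
    ext i; fin_cases i <;> simp [shear]
  have hinv (v : Fin 4 → ℤ) :
      ((T⁻¹ : GL (Fin 4) ℤ) : Matrix (Fin 4) (Fin 4) ℤ).mulVec v = shear (-1) v := by
    have hv : v = shear 1 (shear (-1) v) := by rw [← shear_add, add_neg_cancel, h0]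
    conv_lhs => rw [hv, ← h1, Matrix.mulVec_mulVec, Units.inv_mul, Matrix.one_mulVec]
  induction n generalizing v with
  | zero => simp [h0]
  | succ n ih => rw [zpow_add_one, Units.val_mul, ← Matrix.mulVec_mulVec, h1, ih, shear_add]
  | pred n ih =>
    rw [zpow_sub_one, Units.val_mul, ← Matrix.mulVec_mulVec, hinv, ih, sub_eq_add_neg, shear_add]

theorem mulVec_pow (R : GL (Fin 4) ℤ)
    (hR : (R : Matrix (Fin 4) (Fin 4) ℤ) =
      !![1, 1, 0, 0; 0, -3, -1, 1; 2, 2, 1, 0; 0, -4, -1, 1]) (k : ℕ) (v : Fin 4 → ℤ) :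
    ((R ^ k : GL (Fin 4) ℤ) : Matrix (Fin 4) (Fin 4) ℤ).mulVec v = rot^[k] v := by
  have h1 (v : Fin 4 → ℤ) : (R : Matrix (Fin 4) (Fin 4) ℤ).mulVec v = rot v := by
    ext i
    fin_cases i <;> simp [hR, rot, Matrix.mulVec, dotProduct, Fin.sum_univ_four] <;> ring
  induction k generalizing v with
  | zero => simp
  | succ k ih =>
    rw [pow_succ, Units.val_mul, ← Matrix.mulVec_mulVec, h1, ih, Function.iterate_succ_apply]

theorem map_eq_zpow_mul_pow {K : Type*} [Group K] (f : Multiplicative (ℤ × ZMod 2) →* K)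
    (g : Multiplicative (ℤ × ZMod 2)) :
    f g = f (Multiplicative.ofAdd (1, 0)) ^ g.toAdd.1 *
      f (Multiplicative.ofAdd (0, 1)) ^ g.toAdd.2.val := by
  rw [← map_zpow, ← map_pow, ← map_mul]
  congr 1
  refine Multiplicative.toAdd.injective (?_ : g.toAdd =
    g.toAdd.1 • ((1, 0) : ℤ × ZMod 2) + g.toAdd.2.val • ((0, 1) : ℤ × ZMod 2))
  ext <;> simp

theorem map_eq_pow {n : ℕ} [NeZero n] {K : Type*} [Group K] (f : Multiplicative (ZMod n) →* K)
    (g : Multiplicative (ZMod n)) : f g = f (Multiplicative.ofAdd 1) ^ g.toAdd.val := by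
  rw [← map_pow]
  congr 1
  refine Multiplicative.toAdd.injective (?_ : g.toAdd = g.toAdd.val • (1 : ZMod n))
  simp

theorem fst_ne_zero_of_notMem_range {g : Multiplicative (ℤ × ZMod 2)} (hg : g ∉ incl8₁.range) :
    g.toAdd.1 ≠ 0 := fun h =>
  hg ⟨Multiplicative.ofAdd g.toAdd.2, Multiplicative.toAdd.injective (Prod.ext h.symm rfl)⟩

theorem val_ne_of_notMem_range {g : Multiplicative (ZMod 8)} (hg : g ∉ incl8₂.range) :
    g.toAdd.val ≠ 0 ∧ g.toAdd.val ≠ 4 := by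
  refine ⟨fun h => hg ⟨Multiplicative.ofAdd 0, ?_⟩, fun h => hg ⟨Multiplicative.ofAdd 1, ?_⟩⟩ <;>
    refine Multiplicative.toAdd.injective (ZMod.val_injective 8 ?_) <;> rw [h] <;> decide

/-- The ping-pong sets for the two factors. -/
def pingPongSet : Bool → Set (Fin 4 → ℤ)
  | true => {v | InCones v}
  | false => RotSet

theorem neg_mem_pingPongSet {b : Bool} {v : Fin 4 → ℤ} (hv : v ∈ pingPongSet b) :
    -v ∈ pingPongSet b := by
  cases b
  · exact neg_mem_rotSet hv
  · exact inCones_neg.2 hv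

theorem pushout_injective {R T : GL (Fin 4) ℤ}
    (hR : (R : Matrix (Fin 4) (Fin 4) ℤ) =
      !![1, 1, 0, 0; 0, -3, -1, 1; 2, 2, 1, 0; 0, -4, -1, 1])
    (hT : (T : Matrix (Fin 4) (Fin 4) ℤ) =
      !![1, 0, 0, 0; 0, 1, 0, 1; 0, 0, 1, 0; 0, 0, 0, 1])
    (ψ : Monoid.PushoutI amalgMaps8 →* GL (Fin 4) ℤ)
    (hψT : ψ (Monoid.PushoutI.of (φ := amalgMaps8) true
      (Multiplicative.ofAdd ((1, 0) : ℤ × ZMod 2))) = T)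
    (hψneg : ψ (Monoid.PushoutI.of (φ := amalgMaps8) true
      (Multiplicative.ofAdd ((0, 1) : ℤ × ZMod 2))) = -1)
    (hψR : ψ (Monoid.PushoutI.of (φ := amalgMaps8) false
      (Multiplicative.ofAdd (1 : ZMod 8))) = R) :
    Function.Injective ψ := by
  let _ : MulAction (Monoid.PushoutI amalgMaps8) (Fin 4 → ℤ) :=
    { smul := fun g v => (ψ g : Matrix (Fin 4) (Fin 4) ℤ).mulVec v
      one_smul := fun v => by
        change (ψ 1 : Matrix (Fin 4) (Fin 4) ℤ).mulVec v = v
        simp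
      mul_smul := fun g h v => by
        change (ψ (g * h) : Matrix (Fin 4) (Fin 4) ℤ).mulVec v =
          (ψ g : Matrix (Fin 4) (Fin 4) ℤ).mulVec ((ψ h : Matrix (Fin 4) (Fin 4) ℤ).mulVec v)
        simp }
  have smul_def (g : Monoid.PushoutI amalgMaps8) (v : Fin 4 → ℤ) :
      g • v = (ψ g : Matrix (Fin 4) (Fin 4) ℤ).mulVec v := rfl
  have smul_true (g : Multiplicative (ℤ × ZMod 2)) (v : Fin 4 → ℤ) :
      Monoid.PushoutI.of (φ := amalgMaps8) true g • v = shear g.toAdd.1 v ∨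
        Monoid.PushoutI.of (φ := amalgMaps8) true g • v = -shear g.toAdd.1 v := by
    have hg : ψ (Monoid.PushoutI.of (φ := amalgMaps8) true g) =
        T ^ g.toAdd.1 * (-1) ^ g.toAdd.2.val := by
      rw [← hψT, ← hψneg]
      exact map_eq_zpow_mul_pow (ψ.comp (Monoid.PushoutI.of (φ := amalgMaps8) true)) g
    rw [smul_def, hg]
    refine (neg_one_pow_eq_or (GL (Fin 4) ℤ) g.toAdd.2.val).imp (fun h => ?_) fun h => ?_
    · rw [h, mul_one, mulVec_zpow T hT]
    · rw [h, mul_neg_one, Units.val_neg, Matrix.neg_mulVec, mulVec_zpow T hT]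
  have smul_false (g : Multiplicative (ZMod 8)) (v : Fin 4 → ℤ) :
      Monoid.PushoutI.of (φ := amalgMaps8) false g • v = rot^[g.toAdd.val] v := by
    have hg : ψ (Monoid.PushoutI.of (φ := amalgMaps8) false g) = R ^ g.toAdd.val := by
      rw [← hψR]
      exact map_eq_pow (ψ.comp (Monoid.PushoutI.of (φ := amalgMaps8) false)) g
    rw [smul_def, hg, mulVec_pow R hR]
  have smul_base (h : Multiplicative (ZMod 2)) :
      h = 1 ∨ ∀ v : Fin 4 → ℤ, Monoid.PushoutI.base amalgMaps8 h • v = -v := by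
    have h01 : ∀ a : ZMod 2, a = 0 ∨ a = 1 := by decide
    refine (h01 h.toAdd).imp (fun h => h) fun h1 v => ?_
    obtain rfl : h = Multiplicative.ofAdd 1 := h1
    have : ψ (Monoid.PushoutI.base amalgMaps8 (Multiplicative.ofAdd 1)) = -1 := by
      rw [← hψneg, ← Monoid.PushoutI.of_apply_eq_base amalgMaps8 true]
      rfl
    rw [smul_def, this, Units.val_neg, Units.val_one, Matrix.neg_mulVec, Matrix.one_mulVec]
  rw [injective_iff_map_eq_one]
  intro g hg
  refine Monoid.PushoutI.eq_one_of_smul_eq_of_ping_pong pingPongSet basePoint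
    (fun h hh => (smul_base h).resolve_right fun hv => absurd ((hv _).symm.trans hh) (by decide))
    (fun i h x hx => ?_) (fun i g hg => ?_) (fun i j g hij hg x hx => ?_) (fun i => ?_) g
    (by rw [smul_def, hg, Units.val_one, Matrix.one_mulVec])
  · rcases smul_base h with rfl | hv
    · rwa [map_one, one_smul]
    · rw [hv]
      exact neg_mem_pingPongSet hx
  · cases i
    · rw [smul_false g]
      exact rot_iterate_mem_rotSet (val_ne_of_notMem_range hg) (ZMod.val_lt _)
        fun k hk hk' => rot_iterate_basePoint_mem_rotSet hk hk'
    · have h := (attracted_rot_iterate_basePoint (k := 0) (by decide)).inCones_shear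
        (fst_ne_zero_of_notMem_range hg)
      rcases smul_true g basePoint with hv | hv <;> rw [hv]
      · exact h
      · exact inCones_neg.2 h
  · cases i <;> cases j
    · exact absurd rfl hij
    · rw [smul_false g]
      exact rot_iterate_mem_rotSet (val_ne_of_notMem_range hg) (ZMod.val_lt _)
        fun k hk hk' => InCones.rot_iterate_mem_rotSet hx hk hk'
    · have h := hx.1.inCones_shear (fst_ne_zero_of_notMem_range hg)
      rcases smul_true g x with hv | hv <;> rw [hv]
      · exact h
      · exact inCones_neg.2 h
    · exact absurd rfl hij
  · cases i
    · exact fun h => h.2.1 rfl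
    · exact not_inCones_rot_iterate_basePoint (k := 0) (by decide)

theorem pow_four_eq_neg_one {R : GL (Fin 4) ℤ}
    (hR : (R : Matrix (Fin 4) (Fin 4) ℤ) =
      !![1, 1, 0, 0; 0, -3, -1, 1; 2, 2, 1, 0; 0, -4, -1, 1]) : R ^ 4 = -1 := by
  refine Units.ext ?_
  rw [Units.val_pow_eq_pow_val, Units.val_neg, Units.val_one, hR]
  ext i j
  fin_cases i <;> fin_cases j <;> simp [pow_succ, Matrix.mul_apply, Fin.sum_univ_four]

theorem orderOf_eq_eight {K : Type*} [Group K] [HasDistribNeg K] {R : K} (hR : R ^ 4 = -1)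
    (hneg : (-1 : K) ≠ 1) : orderOf R = 8 := by
  refine orderOf_eq_prime_pow (p := 2) (n := 2) (fun h => hneg ?_) ?_
  · rw [← hR]
    simpa using h
  · rw [show 2 ^ (2 + 1) = 4 * 2 from rfl, pow_mul, hR, neg_one_sq]

/-- The homomorphism `ℤ × ℤ/2ℤ → K` with `(1, 0) ↦ T` and `(0, 1) ↦ -1`. -/
def zpowNegHom {K : Type*} [Group K] [HasDistribNeg K] (T : K) :
    Multiplicative (ℤ × ZMod 2) →* K :=
  MonoidHom.mk' (fun g => T ^ g.toAdd.1 * (-1) ^ g.toAdd.2.val) fun a b => by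
    rw [toAdd_mul, Prod.fst_add, Prod.snd_add, ZMod.val_add,
      ← pow_eq_pow_mod _ (neg_one_sq : (-1 : K) ^ 2 = 1), zpow_add, pow_add, mul_assoc, mul_assoc,
      ((Commute.neg_one_left (T ^ b.toAdd.1)).pow_left a.toAdd.2.val).left_comm]

/-- The homomorphism `ℤ/nℤ → K` with `1 ↦ R`, where `R ^ n = 1`. -/
def zmodPowHom {n : ℕ} [NeZero n] {K : Type*} [Group K] (R : K) (hR : R ^ n = 1) :
    Multiplicative (ZMod n) →* K :=
  MonoidHom.mk' (fun g => R ^ g.toAdd.val) fun a b => by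
    rw [toAdd_mul, ZMod.val_add, ← pow_eq_pow_mod _ hR, pow_add]

theorem exists_pushout_hom {K : Type*} [Group K] [HasDistribNeg K] {R : K} (T : K)
    (hR : R ^ 4 = -1) : ∃ ψ : Monoid.PushoutI amalgMaps8 →* K,
      ψ (Monoid.PushoutI.of (φ := amalgMaps8) true
        (Multiplicative.ofAdd ((1, 0) : ℤ × ZMod 2))) = T ∧
      ψ (Monoid.PushoutI.of (φ := amalgMaps8) true
        (Multiplicative.ofAdd ((0, 1) : ℤ × ZMod 2))) = -1 ∧
      ψ (Monoid.PushoutI.of (φ := amalgMaps8) false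
        (Multiplicative.ofAdd (1 : ZMod 8))) = R := by
  have hR8 : R ^ 8 = 1 := by rw [show 8 = 4 * 2 from rfl, pow_mul, hR, neg_one_sq]
  let fR : Multiplicative (ZMod 8) →* K := zmodPowHom R hR8
  have hfR : fR (Multiplicative.ofAdd 1) = R := by
    change R ^ 1 = R
    exact pow_one R
  have hcomp : fR.comp incl8₂ = (zpowNegHom T).comp incl8₁ := by
    refine MonoidHom.ext fun g => ?_
    rw [map_eq_pow (fR.comp incl8₂), map_eq_pow ((zpowNegHom T).comp incl8₁)]
    congr 1
    trans (-1 : K)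
    · rw [MonoidHom.comp_apply, map_eq_pow fR, hfR, ← hR]
      congr 1
    · symm
      change T ^ (0 : ℤ) * (-1) ^ 1 = (-1 : K)
      simp
  let f : ∀ b, AmalgFactor8 b →* K := fun b => match b with
    | true => zpowNegHom T
    | false => fR
  refine ⟨Monoid.PushoutI.lift f ((zpowNegHom T).comp incl8₁) ?_, ?_, ?_, ?_⟩
  · rintro (_ | _)
    · exact hcomp
    · rfl
  · refine (Monoid.PushoutI.lift_of _ _ _ _).trans ?_
    change T ^ (1 : ℤ) * (-1) ^ 0 = T
    simp
  · refine (Monoid.PushoutI.lift_of _ _ _ _).trans ?_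
    change T ^ (0 : ℤ) * (-1) ^ 1 = (-1 : K)
    simp
  · exact (Monoid.PushoutI.lift_of _ _ _ _).trans hfR

theorem range_eq_closure {K : Type*} [Group K] [HasDistribNeg K] {R T : K} (hR : R ^ 4 = -1)
    (ψ : Monoid.PushoutI amalgMaps8 →* K)
    (hψT : ψ (Monoid.PushoutI.of (φ := amalgMaps8) true
      (Multiplicative.ofAdd ((1, 0) : ℤ × ZMod 2))) = T)
    (hψneg : ψ (Monoid.PushoutI.of (φ := amalgMaps8) true
      (Multiplicative.ofAdd ((0, 1) : ℤ × ZMod 2))) = -1)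
    (hψR : ψ (Monoid.PushoutI.of (φ := amalgMaps8) false
      (Multiplicative.ofAdd (1 : ZMod 8))) = R) :
    ψ.range = Subgroup.closure {R, T} := by
  have hRmem : R ∈ Subgroup.closure {R, T} := Subgroup.subset_closure (by simp)
  have hTmem : T ∈ Subgroup.closure {R, T} := Subgroup.subset_closure (by simp)
  have hof (i : Bool) (g : AmalgFactor8 i) :
      ψ (Monoid.PushoutI.of i g) ∈ Subgroup.closure {R, T} := by
    cases i
    · have h := map_eq_pow (ψ.comp (Monoid.PushoutI.of (φ := amalgMaps8) false)) g
      refine (congrArg (· ∈ Subgroup.closure {R, T}) h).mpr (pow_mem ?_ _)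
      exact hψR.symm ▸ hRmem
    · have h := map_eq_zpow_mul_pow (ψ.comp (Monoid.PushoutI.of (φ := amalgMaps8) true)) g
      refine (congrArg (· ∈ Subgroup.closure {R, T}) h).mpr
        (mul_mem (zpow_mem ?_ _) (pow_mem ?_ _))
      · exact hψT.symm ▸ hTmem
      · exact (hψneg.trans hR.symm) ▸ pow_mem hRmem 4
  apply le_antisymm
  · rintro _ ⟨x, rfl⟩
    induction x using Monoid.PushoutI.induction_on with
    | of i g => exact hof i g
    | base h =>
      rw [← Monoid.PushoutI.of_apply_eq_base amalgMaps8 true]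
      exact hof true _
    | mul x y hx hy =>
      rw [map_mul]
      exact mul_mem hx hy
  · rw [Subgroup.closure_le]
    rintro _ (rfl | rfl)
    exacts [⟨_, hψR⟩, ⟨_, hψT⟩]

end HypergeometricPingPong
/-- For `d = 2`, `k = 4`, the hypergeometric matrices `R = T·U` and `T`
satisfy `R^4 = -1` (so `R` has order `8`, and `-1` lies in the subgroup generated by
`{T, -1}` and in the subgroup generated by `R`), the homomorphism from the amalgamated
free product `(ℤ × ℤ/2ℤ) ∗_{ℤ/2ℤ} ℤ/8ℤ` to `GL(4,ℤ)` determined by `(1,0) ↦ T`,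
`(0,1) ↦ -1` and the generator of `ℤ/8ℤ ↦ R` is injective, and consequently the subgroup
of `GL(4,ℤ)` generated by `R` and `T` is isomorphic to `(ℤ × ℤ/2ℤ) ∗_{ℤ/2ℤ} ℤ/8ℤ`. -/
theorem monodromy_amalgam_d2_k4
    (R T : GL (Fin 4) ℤ)
    (hR : (R : Matrix (Fin 4) (Fin 4) ℤ) =
      !![1, 1, 0, 0; 0, -3, -1, 1; 2, 2, 1, 0; 0, -4, -1, 1])
    (hT : (T : Matrix (Fin 4) (Fin 4) ℤ) =
      !![1, 0, 0, 0; 0, 1, 0, 1; 0, 0, 1, 0; 0, 0, 0, 1]) :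
    R ^ 4 = -1 ∧ orderOf R = 8 ∧
    (-1 : GL (Fin 4) ℤ) ∈ Subgroup.closure ({T, -1} : Set (GL (Fin 4) ℤ)) ∧
    (-1 : GL (Fin 4) ℤ) ∈ Subgroup.closure ({R} : Set (GL (Fin 4) ℤ)) ∧
    (∀ ψ : Monoid.PushoutI amalgMaps8 →* GL (Fin 4) ℤ,
        ψ (Monoid.PushoutI.of (φ := amalgMaps8) true
            (Multiplicative.ofAdd ((1, 0) : ℤ × ZMod 2))) = T →
        ψ (Monoid.PushoutI.of (φ := amalgMaps8) true
            (Multiplicative.ofAdd ((0, 1) : ℤ × ZMod 2))) = -1 →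
        ψ (Monoid.PushoutI.of (φ := amalgMaps8) false
            (Multiplicative.ofAdd (1 : ZMod 8))) = R →
        Function.Injective ψ) ∧
    Nonempty (Monoid.PushoutI amalgMaps8 ≃*
      (Subgroup.closure ({R, T} : Set (GL (Fin 4) ℤ)))) := by
  have hR4 := HypergeometricPingPong.pow_four_eq_neg_one hR
  have hneg : (-1 : GL (Fin 4) ℤ) ≠ 1 := fun h => by
    have h00 := congrArg (fun g : GL (Fin 4) ℤ => (g : Matrix (Fin 4) (Fin 4) ℤ) 0 0) h
    simp at h00
  refine ⟨hR4, HypergeometricPingPong.orderOf_eq_eight hR4 hneg, Subgroup.subset_closure (by simp),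
    ?_, HypergeometricPingPong.pushout_injective hR hT, ?_⟩
  · rw [← hR4]
    exact pow_mem (Subgroup.subset_closure (Set.mem_singleton R)) 4
  obtain ⟨ψ, hψT, hψneg, hψR⟩ := HypergeometricPingPong.exists_pushout_hom T hR4
  have hinj := HypergeometricPingPong.pushout_injective hR hT ψ hψT hψneg hψR
  exact ⟨(MonoidHom.ofInjective hinj).trans (MulEquiv.subgroupCongr
    (HypergeometricPingPong.range_eq_closure hR4 ψ hψT hψneg hψR))⟩
end

section
/- Let R and T be the above 4×4 integer matrices with d = 1 and k = 4. Then R^6 = -I (so R has order 12), and the group homomorphism from the amalgamated free product (ℤ × ℤ/2ℤ) ∗_{ℤ/2ℤ} ℤ/12ℤ — the pushout of the homomorphisms ℤ/2ℤ → ℤ × ℤ/2ℤ sending 1 ↦ (0,1) and ℤ/2ℤ → ℤ/12ℤ sending 1 ↦ 6 — to GL(4, ℤ) determined by (1,0) ↦ T, (0,1) ↦ -I, and the generator of ℤ/12ℤ ↦ R, is injective; in particular the subgroup of GL(4, ℤ) generated by R and T is isomorphic to (ℤ × ℤ/2ℤ) ∗_{ℤ/2ℤ} ℤ/12ℤ.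 -/
open scoped MatrixGroups

/-- The two factors of the amalgamated product `(ℤ × ℤ/2ℤ) ∗_{ℤ/2ℤ} ℤ/12ℤ`:
the factor at `true` is `ℤ × ℤ/2ℤ` and the factor at `false` is `ℤ/12ℤ`
(written multiplicatively). -/
def AmalgFactor12 : Bool → Type :=
  fun b => match b with
  | true => Multiplicative (ℤ × ZMod 2)
  | false => Multiplicative (ZMod 12)

instance : ∀ b, Group (AmalgFactor12 b) :=
  fun b => match b with
  | true => inferInstanceAs (Group (Multiplicative (ℤ × ZMod 2)))
  | false => inferInstanceAs (Group (Multiplicative (ZMod 12)))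

/-- The map `ℤ/2ℤ → ℤ × ℤ/2ℤ` sending `1 ↦ (0,1)` (written multiplicatively). -/
def incl12₁ : Multiplicative (ZMod 2) →* Multiplicative (ℤ × ZMod 2) :=
  AddMonoidHom.toMultiplicative ((0 : ZMod 2 →+ ℤ).prod (AddMonoidHom.id (ZMod 2)))

/-- The map `ℤ/2ℤ → ℤ/12ℤ` sending `1 ↦ 6` (written multiplicatively). -/
def incl12₂ : Multiplicative (ZMod 2) →* Multiplicative (ZMod 12) :=
  AddMonoidHom.toMultiplicative (ZMod.lift 2 ⟨zmultiplesHom (ZMod 12) 6, by decide⟩)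

/-- The pair of maps defining the pushout `(ℤ × ℤ/2ℤ) ∗_{ℤ/2ℤ} ℤ/12ℤ`. -/
def amalgMaps12 : ∀ b, Multiplicative (ZMod 2) →* AmalgFactor12 b :=
  fun b => match b with
  | true => incl12₁
  | false => incl12₂

/-- A polyhedral cone in `ℤ⁴`, given by its seven facets. -/
def PingCone (v : Fin 4 → ℤ) : Prop :=
  0 ≤ 23 * v 0 + 11 * v 1 - 5 * v 3 ∧ 0 ≤ v 1 - v 3 ∧
  0 ≤ 3 * v 0 + 14 * v 1 + 17 * v 2 - 11 * v 3 ∧ 0 ≤ -v 0 + 2 * v 1 + 2 * v 2 - 2 * v 3 ∧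
  0 ≤ -v 0 ∧ 0 ≤ 2 * v 0 + v 3 ∧ 0 ≤ v 0 + v 2 + v 3

instance : DecidablePred PingCone := fun _ => by unfold PingCone; infer_instance

/-- The action of `R` on column vectors. -/
def actR (v : Fin 4 → ℤ) : Fin 4 → ℤ :=
  ![v 0 + v 1, -3 * v 1 - v 2 + v 3, v 0 + v 1 + v 2, -4 * v 1 - v 2 + v 3]

/-- The action of `T ^ n` on column vectors. -/
def actT (n : ℤ) (v : Fin 4 → ℤ) : Fin 4 → ℤ := ![v 0, v 1 + n * v 3, v 2, v 3]

/-- An involution conjugating `R` to `R⁻¹` and `T` to `T⁻¹`. -/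
def flipRT (v : Fin 4 → ℤ) : Fin 4 → ℤ := ![v 0, v 3 - v 1, v 0 - v 2, v 3]

/-- The union of `PingCone` with its negative. -/
def PingDoubleCone (v : Fin 4 → ℤ) : Prop := PingCone v ∨ PingCone (-v)

instance : DecidablePred PingDoubleCone := fun _ => by unfold PingDoubleCone; infer_instance

/-- The ping-pong set which nontrivial powers of `T` map into. -/
def PingX (v : Fin 4 → ℤ) : Prop := PingDoubleCone v ∨ PingDoubleCone (flipRT v)

instance : DecidablePred PingX := fun _ => by unfold PingX; infer_instance

/-- The ping-pong set which the powers of `R` outside `{1, -1}` map into. -/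
def PingY (v : Fin 4 → ℤ) : Prop :=
  PingDoubleCone (actT 1 v) ∧ PingDoubleCone (flipRT (actT (-1) v))

instance : DecidablePred PingY := fun _ => by unfold PingY; infer_instance

theorem PingCone.actT {v : Fin 4 → ℤ} (hv : PingCone v) {n : ℤ} (hn : 0 ≤ n) :
    PingCone (actT n v) := by
  have h3 : 0 ≤ n * v 3 := by
    obtain ⟨-, -, -, -, h, h', -⟩ := hv
    exact mul_nonneg hn (by lia)
  simp only [PingCone, _root_.actT, Matrix.cons_val] at hv ⊢
  lia

theorem actT_add (m n : ℤ) (v : Fin 4 → ℤ) : actT (m + n) v = actT m (actT n v) := by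
  ext i; fin_cases i <;> simp [actT]; ring

theorem actT_neg (n : ℤ) (v : Fin 4 → ℤ) : actT n (-v) = -actT n v := by
  ext i; fin_cases i <;> simp [actT]; ring

theorem flipRT_actT (n : ℤ) (v : Fin 4 → ℤ) : flipRT (actT n v) = actT (-n) (flipRT v) := by
  ext i; fin_cases i <;> simp [actT, flipRT]; ring

theorem PingDoubleCone.actT {v : Fin 4 → ℤ} (hv : PingDoubleCone v) {n : ℤ} (hn : 0 ≤ n) :
    PingDoubleCone (actT n v) :=
  hv.imp (·.actT hn) fun h => by rw [← actT_neg]; exact h.actT hn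

theorem PingY.pingX_actT {v : Fin 4 → ℤ} (hv : PingY v) {n : ℤ} (hn : n ≠ 0) :
    PingX (actT n v) := by
  rcases hn.lt_or_gt with h | h
  · right
    have := hv.2.actT (n := -n - 1) (by lia)
    rwa [flipRT_actT, ← actT_add, show -n - 1 + - -1 = -n by ring, ← flipRT_actT] at this
  · left
    have := hv.1.actT (n := n - 1) (by lia)
    rwa [← actT_add, sub_add_cancel] at this

theorem flipRT_neg (v : Fin 4 → ℤ) : flipRT (-v) = -flipRT v := by
  ext j; fin_cases j <;> simp [flipRT] <;> ring

theorem iterate_actR_neg (i : ℕ) (v : Fin 4 → ℤ) : actR^[i] (-v) = -actR^[i] v := by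
  have h : Function.Commute actR Neg.neg := fun v => by
    ext j; fin_cases j <;> simp [actR] <;> ring
  exact h.iterate_left i v

theorem flipRT_flipRT (v : Fin 4 → ℤ) : flipRT (flipRT v) = v := by
  ext j; fin_cases j <;> simp [flipRT]

theorem iterate_six_actR (v : Fin 4 → ℤ) : actR^[6] v = -v := by
  have h (v) : actR^[3] v =
      ![2 * v 1 - v 3, -4 * v 1 - v 2 + 2 * v 3, 2 * v 0 + v 1,
        v 0 - 8 * v 1 - 2 * v 2 + 4 * v 3] := by
    ext j; fin_cases j <;> simp [actR] <;> ring
  rw [Function.iterate_add_apply actR 3 3, h, h]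
  ext j; fin_cases j <;> simp <;> ring

theorem actR_flipRT_actR (v : Fin 4 → ℤ) : actR (flipRT (actR v)) = flipRT v := by
  ext j; fin_cases j <;> simp [flipRT, actR] <;> ring

theorem flipRT_iterate_actR {i : ℕ} (hi : i ≤ 6) (v : Fin 4 → ℤ) :
    flipRT (actR^[i] v) = -actR^[6 - i] (flipRT v) := by
  have h : actR^[i] (flipRT (actR^[i] v)) = flipRT v := by
    clear hi
    induction i generalizing v with
    | zero => rfl
    | succ i ih =>
      rw [Function.iterate_succ_apply, Function.iterate_succ_apply', actR_flipRT_actR, ih]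
  rw [← h, ← Function.iterate_add_apply, Nat.sub_add_cancel hi, iterate_six_actR, neg_neg]

theorem PingCone.pingDoubleCone_iterate_actR {v : Fin 4 → ℤ} (hv : PingCone v) {i : ℕ}
    (hi : 1 ≤ i) (hi' : i ≤ 5) : PingDoubleCone (_root_.actT 1 (actR^[i] v)) := by
  interval_cases i <;>
    simp only [PingDoubleCone, PingCone, _root_.actT, actR, Function.iterate_succ,
      Function.iterate_zero, Function.comp, id, Matrix.cons_val, Pi.neg_apply] at hv ⊢ <;>
    first
    | exact Or.inl (by lia)
    | exact Or.inr (by lia)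

theorem PingCone.pingDoubleCone_iterate_actR_flipRT {v : Fin 4 → ℤ} (hv : PingCone v) {i : ℕ}
    (hi : 1 ≤ i) (hi' : i ≤ 5) : PingDoubleCone (_root_.actT 1 (actR^[i] (flipRT v))) := by
  interval_cases i <;>
    simp only [PingDoubleCone, PingCone, flipRT, _root_.actT, actR, Function.iterate_succ,
      Function.iterate_zero, Function.comp, id, Matrix.cons_val, Pi.neg_apply] at hv ⊢ <;>
    first
    | exact Or.inl (by lia)
    | exact Or.inr (by lia)

theorem PingDoubleCone.neg {v : Fin 4 → ℤ} (hv : PingDoubleCone v) : PingDoubleCone (-v) := by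
  rwa [PingDoubleCone, neg_neg, or_comm]

theorem PingX.pingDoubleCone_iterate_actR {v : Fin 4 → ℤ} (hv : PingX v) {i : ℕ} (hi : 1 ≤ i)
    (hi' : i ≤ 5) : PingDoubleCone (actT 1 (actR^[i] v)) := by
  rcases hv with (hv | hv) | (hv | hv)
  · exact hv.pingDoubleCone_iterate_actR hi hi'
  · simpa [iterate_actR_neg, actT_neg] using (hv.pingDoubleCone_iterate_actR hi hi').neg
  · simpa [flipRT_flipRT] using hv.pingDoubleCone_iterate_actR_flipRT hi hi'
  · simpa [flipRT_neg, flipRT_flipRT, iterate_actR_neg, actT_neg] using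
      (hv.pingDoubleCone_iterate_actR_flipRT hi hi').neg

theorem PingX.pingY_iterate_actR {v : Fin 4 → ℤ} (hv : PingX v) {i : ℕ} (hi : 1 ≤ i)
    (hi' : i ≤ 5) : PingY (actR^[i] v) := by
  refine ⟨hv.pingDoubleCone_iterate_actR hi hi', ?_⟩
  have hv' : PingX (flipRT v) := by rwa [PingX, flipRT_flipRT, or_comm]
  rw [flipRT_actT, neg_neg, flipRT_iterate_actR (by lia), actT_neg]
  exact (hv'.pingDoubleCone_iterate_actR (by lia) (by lia)).neg

/-- A vector all of whose images under powers of `R` lie in `PingY` but not in `PingX`. -/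
def pingBase : Fin 4 → ℤ := ![-1, 0, 0, 4]

theorem pingY_iterate_actR_pingBase {i : ℕ} (hi : i < 12) : PingY (actR^[i] pingBase) := by
  interval_cases i <;> decide

theorem not_pingX_iterate_actR_pingBase {i : ℕ} (hi : i < 12) :
    ¬ PingX (actR^[i] pingBase) := by
  interval_cases i <;> decide

/-- The elements `t ^ n₁ * r ^ i₁ * t ^ n₂ * r ^ i₂ * ⋯ * t ^ nₘ * r ^ iₘ`, with all `n` nonzero and
all `i` in `{1, …, 5}`, except that the last `i` may also be zero. -/
inductive IsAltWord {G : Type*} [Group G] (t r : G) : G → Prop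
  | last (n : ℤ) (hn : n ≠ 0) (i : ℕ) (hi : i ≤ 5) : IsAltWord t r (t ^ n * r ^ i)
  | step (n : ℤ) (hn : n ≠ 0) (i : ℕ) (hi : 1 ≤ i) (hi' : i ≤ 5) (g : G)
      (hg : IsAltWord t r g) : IsAltWord t r (t ^ n * r ^ i * g)

section AltWord

variable {G : Type*} [Group G] {t r : G}

/-- The set of elements `r ^ k` and `r ^ k * w`, with `w` an alternating word, is stable under left
multiplication by powers of `t`. -/
theorem IsAltWord.exists_zpow_mul_eq (hrt : Commute (r ^ 6) t) (m : ℤ) {g : G}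
    (hg : ∃ k : ℕ, ∃ w, (w = 1 ∨ IsAltWord t r w) ∧ g = r ^ k * w) :
    ∃ k : ℕ, ∃ w, (w = 1 ∨ IsAltWord t r w) ∧ t ^ m * g = r ^ k * w := by
  obtain ⟨k, w, hw, rfl⟩ := hg
  rcases eq_or_ne m 0 with rfl | hm
  · exact ⟨k, w, hw, by simp⟩
  have hk : r ^ k = r ^ (6 * (k / 6)) * r ^ (k % 6) := by rw [← pow_add, Nat.div_add_mod]
  have hcomm : Commute (t ^ m) (r ^ (6 * (k / 6))) := by
    rw [pow_mul]; exact ((hrt.pow_left _).zpow_right m).symm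
  suffices ∃ j : ℕ, ∃ w', (w' = 1 ∨ IsAltWord t r w') ∧
      t ^ m * (r ^ (k % 6) * w) = r ^ j * w' by
    obtain ⟨j, w', hw', h⟩ := this
    refine ⟨6 * (k / 6) + j, w', hw', ?_⟩
    rw [hk, mul_assoc, ← mul_assoc (t ^ m), hcomm.eq, mul_assoc, h, pow_add, mul_assoc]
  rcases Nat.eq_zero_or_pos (k % 6) with h0 | h0
  · rw [h0]
    rcases hw with rfl | ⟨n, hn, i, hi⟩ | ⟨n, hn, i, hi, hi', g, hg⟩
    · exact ⟨0, t ^ m * r ^ 0, .inr (.last m hm 0 (by lia)), by simp⟩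
    · rcases eq_or_ne (m + n) 0 with h | h
      · exact ⟨i, 1, .inl rfl, by simp [← mul_assoc, ← zpow_add, h]⟩
      · exact ⟨0, _, .inr (.last _ h i hi), by simp [← mul_assoc, ← zpow_add]⟩
    · rcases eq_or_ne (m + n) 0 with h | h
      · exact ⟨i, g, .inr hg, by simp [← mul_assoc, ← zpow_add, h]⟩
      · exact ⟨0, _, .inr (.step _ h i hi hi' g hg), by simp [← mul_assoc, ← zpow_add]⟩
  · have h5 : k % 6 ≤ 5 := by lia
    rcases hw with rfl | hw
    · exact ⟨0, _, .inr (.last m hm _ h5), by simp⟩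
    · exact ⟨0, _, .inr (.step m hm _ h0 h5 w hw), by simp [mul_assoc]⟩

theorem exists_pow_mul_isAltWord (hr : r ^ 12 = 1) (hrt : Commute (r ^ 6) t)
    (htop : Subgroup.closure {r, t} = ⊤) (g : G) :
    ∃ k : ℕ, ∃ w, (w = 1 ∨ IsAltWord t r w) ∧ g = r ^ k * w := by
  have hinv : r⁻¹ = r ^ 11 := by rw [inv_eq_iff_mul_eq_one, ← pow_succ', hr]
  have hpow {j : ℕ} {y : G} (hy : ∃ k : ℕ, ∃ w, (w = 1 ∨ IsAltWord t r w) ∧ y = r ^ k * w) :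
      ∃ k : ℕ, ∃ w, (w = 1 ∨ IsAltWord t r w) ∧ r ^ j * y = r ^ k * w := by
    obtain ⟨k, w, hw, rfl⟩ := hy
    exact ⟨j + k, w, hw, by rw [pow_add, mul_assoc]⟩
  induction htop ▸ Subgroup.mem_top g using Subgroup.closure_induction_left with
  | one => exact ⟨0, 1, .inl rfl, by simp⟩
  | mul_left x hx y _ ih =>
    rcases hx with rfl | rfl
    · simpa using hpow (j := 1) ih
    · simpa using IsAltWord.exists_zpow_mul_eq hrt 1 ih
  | inv_mul_cancel x hx y _ ih =>
    rcases hx with rfl | rfl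
    · rw [hinv]; exact hpow ih
    · simpa using IsAltWord.exists_zpow_mul_eq hrt (-1) ih

end AltWord

theorem pow_mulVec_eq_iterate_actR {R : GL (Fin 4) ℤ}
    (hR : (R : Matrix (Fin 4) (Fin 4) ℤ) =
      !![1, 1, 0, 0; 0, -3, -1, 1; 1, 1, 1, 0; 0, -4, -1, 1])
    (i : ℕ) (v : Fin 4 → ℤ) : (R ^ i).val.mulVec v = actR^[i] v := by
  induction i generalizing v with
  | zero => simp
  | succ i ih =>
    have h : R.val.mulVec v = actR v := by
      rw [hR]
      ext j
      fin_cases j <;> simp [Matrix.mulVec, dotProduct, Fin.sum_univ_four, actR] <;> ring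
    rw [pow_succ, Units.val_mul, ← Matrix.mulVec_mulVec, h, ih, Function.iterate_succ_apply]

theorem zpow_mulVec_eq_actT {T : GL (Fin 4) ℤ}
    (hT : (T : Matrix (Fin 4) (Fin 4) ℤ) =
      !![1, 0, 0, 0; 0, 1, 0, 1; 0, 0, 1, 0; 0, 0, 0, 1])
    (n : ℤ) (v : Fin 4 → ℤ) : (T ^ n).val.mulVec v = actT n v := by
  have h (v) : T.val.mulVec v = actT 1 v := by
    rw [hT]; ext j; fin_cases j <;> simp [Matrix.mulVec, dotProduct, Fin.sum_univ_four, actT]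
  have h' (v) : (T⁻¹).val.mulVec v = actT (-1) v := by
    have : v = T.val.mulVec (actT (-1) v) := by
      rw [h, ← actT_add]; ext j; fin_cases j <;> simp [actT]
    conv_lhs => rw [this, Matrix.mulVec_mulVec, ← Units.val_mul]
    simp
  induction n generalizing v with
  | zero => ext j; fin_cases j <;> simp [actT]
  | succ i ih => rw [zpow_add_one, Units.val_mul, ← Matrix.mulVec_mulVec, h, ih, ← actT_add]
  | pred i ih =>
    rw [zpow_sub_one, Units.val_mul, ← Matrix.mulVec_mulVec, h', ih, ← actT_add, ← sub_eq_add_neg]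

theorem pow_six_eq_neg_one {R : GL (Fin 4) ℤ}
    (hR : (R : Matrix (Fin 4) (Fin 4) ℤ) =
      !![1, 1, 0, 0; 0, -3, -1, 1; 1, 1, 1, 0; 0, -4, -1, 1]) : R ^ 6 = -1 := by
  ext1
  rw [Units.val_pow_eq_pow_val, hR]
  decide

theorem orderOf_eq_twelve {R : GL (Fin 4) ℤ}
    (hR : (R : Matrix (Fin 4) (Fin 4) ℤ) =
      !![1, 1, 0, 0; 0, -3, -1, 1; 1, 1, 1, 0; 0, -4, -1, 1]) : orderOf R = 12 := by
  have h6 := pow_six_eq_neg_one hR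
  refine (orderOf_eq_iff (by norm_num)).2 ⟨by rw [pow_mul R 6 2, h6, neg_one_sq], ?_⟩
  intro m hm hm' h
  have h0 : actR^[m] pingBase = pingBase := by
    rw [← pow_mulVec_eq_iterate_actR hR, h]; simp
  interval_cases m <;> revert h0 <;> decide

/-- Ping-pong: a representation sending `r` to `R` and `t` to `T` is injective as soon as `r` and
`t` satisfy the defining relations of the amalgamated product. -/
theorem injective_of_map_eq {R T : GL (Fin 4) ℤ}
    (hR : (R : Matrix (Fin 4) (Fin 4) ℤ) =
      !![1, 1, 0, 0; 0, -3, -1, 1; 1, 1, 1, 0; 0, -4, -1, 1])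
    (hT : (T : Matrix (Fin 4) (Fin 4) ℤ) =
      !![1, 0, 0, 0; 0, 1, 0, 1; 0, 0, 1, 0; 0, 0, 0, 1])
    {G : Type*} [Group G] {t r : G} (hr : r ^ 12 = 1) (hrt : Commute (r ^ 6) t)
    (htop : Subgroup.closure {r, t} = ⊤) {ψ : G →* GL (Fin 4) ℤ} (hψr : ψ r = R)
    (hψt : ψ t = T) : Function.Injective ψ := by
  have hword {w : G} (hw : IsAltWord t r w) : PingX ((ψ w).val.mulVec pingBase) := by
    induction hw with
    | last n hn i hi =>
      rw [map_mul, map_zpow, map_pow, hψr, hψt, Units.val_mul, ← Matrix.mulVec_mulVec,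
        pow_mulVec_eq_iterate_actR hR, zpow_mulVec_eq_actT hT]
      exact (pingY_iterate_actR_pingBase (by lia)).pingX_actT hn
    | step n hn i hi hi' g _ ih =>
      rw [map_mul, map_mul, map_zpow, map_pow, hψr, hψt, Units.val_mul, Units.val_mul,
        ← Matrix.mulVec_mulVec, ← Matrix.mulVec_mulVec, pow_mulVec_eq_iterate_actR hR,
        zpow_mulVec_eq_actT hT]
      exact (ih.pingY_iterate_actR hi hi').pingX_actT hn
  refine (injective_iff_map_eq_one ψ).2 fun g hg => ?_
  obtain ⟨k, w, hw, rfl⟩ := exists_pow_mul_isAltWord hr hrt htop g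
  rw [map_mul, map_pow, hψr] at hg
  rcases hw with rfl | hw
  · rw [map_one, mul_one] at hg
    obtain ⟨c, rfl⟩ := orderOf_eq_twelve hR ▸ orderOf_dvd_of_pow_eq_one hg
    rw [mul_one, pow_mul, hr, one_pow]
  · have hR12 : R ^ 12 = 1 := by rw [← hψr, ← map_pow, hr, map_one]
    have h : ψ w = R ^ (11 * k % 12) := by
      rw [← pow_mod_orderOf R, orderOf_eq_twelve hR, Nat.mod_mod, ← orderOf_eq_twelve hR,
        pow_mod_orderOf, eq_inv_of_mul_eq_one_right hg, inv_eq_iff_mul_eq_one, ← pow_add,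
        show k + 11 * k = 12 * k by ring, pow_mul, hR12, one_pow]
    have hX := hword hw
    rw [h, pow_mulVec_eq_iterate_actR hR] at hX
    exact absurd hX <| not_pingX_iterate_actR_pingBase (Nat.mod_lt _ (by norm_num))

/-- The map from `ℤ × ℤ/2ℤ` to the amalgamated product. -/
def amalgOfProd12 : Multiplicative (ℤ × ZMod 2) →* Monoid.PushoutI amalgMaps12 :=
  Monoid.PushoutI.of (φ := amalgMaps12) true

/-- The map from `ℤ/12ℤ` to the amalgamated product. -/
def amalgOfZMod12 : Multiplicative (ZMod 12) →* Monoid.PushoutI amalgMaps12 :=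
  Monoid.PushoutI.of (φ := amalgMaps12) false

/-- The first generator of `ℤ × ℤ/2ℤ` in the amalgamated product. -/
def amalgT12 : Monoid.PushoutI amalgMaps12 := amalgOfProd12 (Multiplicative.ofAdd (1, 0))

/-- The generator of `ℤ/12ℤ` in the amalgamated product. -/
def amalgR12 : Monoid.PushoutI amalgMaps12 := amalgOfZMod12 (Multiplicative.ofAdd 1)

theorem amalgR12_pow (n : ℕ) :
    amalgR12 ^ n = amalgOfZMod12 (Multiplicative.ofAdd (n : ZMod 12)) := by
  rw [amalgR12, ← map_pow, ← ofAdd_nsmul, nsmul_one]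

theorem amalgT12_zpow (n : ℤ) :
    amalgT12 ^ n = amalgOfProd12 (Multiplicative.ofAdd (n, 0)) := by
  rw [amalgT12, ← map_zpow, ← ofAdd_zsmul]
  simp

theorem amalgR12_pow_twelve : amalgR12 ^ 12 = 1 := by
  rw [amalgR12_pow]
  exact map_one amalgOfZMod12

theorem amalgR12_pow_six : amalgR12 ^ 6 = amalgOfProd12 (Multiplicative.ofAdd (0, 1)) := by
  rw [amalgR12_pow]
  have h := Monoid.PushoutI.of_apply_eq_base amalgMaps12
  exact (h false (Multiplicative.ofAdd 1)).trans (h true (Multiplicative.ofAdd 1)).symm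

theorem commute_amalgR12_pow_six_amalgT12 : Commute (amalgR12 ^ 6) amalgT12 := by
  rw [amalgR12_pow_six, amalgT12]
  exact (Commute.all _ _).map amalgOfProd12

theorem amalgOfProd12_eq (a : ℤ) (b : ZMod 2) :
    amalgOfProd12 (Multiplicative.ofAdd (a, b)) = amalgT12 ^ a * (amalgR12 ^ 6) ^ b.val := by
  rw [amalgT12_zpow, amalgR12_pow_six, ← map_pow, ← map_mul, ← ofAdd_nsmul, ← ofAdd_add]
  simp

theorem amalgOfZMod12_eq (a : ZMod 12) :
    amalgOfZMod12 (Multiplicative.ofAdd a) = amalgR12 ^ a.val := by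
  rw [amalgR12_pow, ZMod.natCast_zmod_val]

theorem closure_amalgR12_amalgT12 : Subgroup.closure {amalgR12, amalgT12} = ⊤ := by
  have hR : amalgR12 ∈ Subgroup.closure {amalgR12, amalgT12} :=
    Subgroup.subset_closure (by simp)
  have hT : amalgT12 ∈ Subgroup.closure {amalgR12, amalgT12} :=
    Subgroup.subset_closure (by simp)
  have hof (i : Bool) (g : AmalgFactor12 i) :
      Monoid.PushoutI.of (φ := amalgMaps12) i g ∈ Subgroup.closure {amalgR12, amalgT12} := by
    match i, g with
    | true, (g : ℤ × ZMod 2) =>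
      change amalgOfProd12 (Multiplicative.ofAdd (g.1, g.2)) ∈ _
      rw [amalgOfProd12_eq]
      exact mul_mem (zpow_mem hT _) (pow_mem (pow_mem hR _) _)
    | false, (g : ZMod 12) =>
      change amalgOfZMod12 (Multiplicative.ofAdd g) ∈ _
      rw [amalgOfZMod12_eq]
      exact pow_mem hR _
  refine (Subgroup.eq_top_iff' _).2 fun g => ?_
  induction g using Monoid.PushoutI.induction_on with
  | of i g => exact hof i g
  | base h =>
    rw [← Monoid.PushoutI.of_apply_eq_base amalgMaps12 true]
    exact hof _ _
  | mul x y hx hy => exact mul_mem hx hy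

/-- The universal property of the amalgamated product, in terms of generators and relations. -/
theorem exists_amalg_hom {G : Type*} [Group G] {t r : G} (hr : r ^ 12 = 1)
    (hrt : Commute (r ^ 6) t) :
    ∃ ψ : Monoid.PushoutI amalgMaps12 →* G, ψ amalgR12 = r ∧ ψ amalgT12 = t := by
  let f : Multiplicative (ZMod 12) →* G := AddMonoidHom.toMultiplicativeLeft
    (ZMod.lift 12 ⟨zmultiplesHom (Additive G) (.ofMul r), congrArg Additive.ofMul
      ((zpow_natCast r 12).trans hr)⟩)
  have hf : f (Multiplicative.ofAdd 1) = r := by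
    change Additive.toMul (ZMod.lift 12 _ ((1 : ℤ) : ZMod 12)) = r
    rw [ZMod.lift_coe]
    simp
  have hcomm (n : Multiplicative ℤ) (x : Multiplicative (ZMod 2)) :
      Commute (zpowersHom G t n) (f.comp incl12₂ x) := by
    rw [zpowersHom_apply]
    refine Commute.zpow_left ?_ _
    obtain rfl | rfl : x = 1 ∨ x = Multiplicative.ofAdd 1 := by revert x; decide
    · simp
    · have : f.comp incl12₂ (Multiplicative.ofAdd 1) = r ^ 6 := by
        rw [← hf, ← map_pow]; rfl
      rw [this]
      exact hrt.symm
  let g : Multiplicative (ℤ × ZMod 2) →* G :=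
    ((zpowersHom G t).noncommCoprod (f.comp incl12₂) hcomm).comp
      (MulEquiv.prodMultiplicative ℤ (ZMod 2)).toMonoidHom
  let F (b : Bool) : AmalgFactor12 b →* G := match b with
    | true => g
    | false => f
  have hF (b : Bool) : (F b).comp (amalgMaps12 b) = f.comp incl12₂ := by
    cases b
    · rfl
    · ext x
      exact (congrArg (· * f.comp incl12₂ x) (map_one (zpowersHom G t))).trans (one_mul _)
  refine ⟨Monoid.PushoutI.lift F (f.comp incl12₂) hF, ?_, ?_⟩
  · exact (Monoid.PushoutI.lift_of F _ hF (i := false) _).trans hf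
  · refine (Monoid.PushoutI.lift_of F _ hF (i := true) _).trans ?_
    exact (congrArg₂ (· * ·) (zpow_one t) (map_one (f.comp incl12₂))).trans (mul_one t)

/-- For `d = 1`, `k = 4`, the hypergeometric matrices `R = T·U` and `T`
satisfy `R^6 = -1` (so `R` has order `12`, and `-1` lies in the subgroup generated by
`{T, -1}` and in the subgroup generated by `R`), the homomorphism from the amalgamated
free product `(ℤ × ℤ/2ℤ) ∗_{ℤ/2ℤ} ℤ/12ℤ` to `GL(4,ℤ)` determined by `(1,0) ↦ T`,
`(0,1) ↦ -1` and the generator of `ℤ/12ℤ ↦ R` is injective, and consequently the subgroup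
of `GL(4,ℤ)` generated by `R` and `T` is isomorphic to `(ℤ × ℤ/2ℤ) ∗_{ℤ/2ℤ} ℤ/12ℤ`. -/
theorem monodromy_amalgam_d1_k4
    (R T : GL (Fin 4) ℤ)
    (hR : (R : Matrix (Fin 4) (Fin 4) ℤ) =
      !![1, 1, 0, 0; 0, -3, -1, 1; 1, 1, 1, 0; 0, -4, -1, 1])
    (hT : (T : Matrix (Fin 4) (Fin 4) ℤ) =
      !![1, 0, 0, 0; 0, 1, 0, 1; 0, 0, 1, 0; 0, 0, 0, 1]) :
    R ^ 6 = -1 ∧ orderOf R = 12 ∧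
    (-1 : GL (Fin 4) ℤ) ∈ Subgroup.closure ({T, -1} : Set (GL (Fin 4) ℤ)) ∧
    (-1 : GL (Fin 4) ℤ) ∈ Subgroup.closure ({R} : Set (GL (Fin 4) ℤ)) ∧
    (∀ ψ : Monoid.PushoutI amalgMaps12 →* GL (Fin 4) ℤ,
        ψ (Monoid.PushoutI.of (φ := amalgMaps12) true
            (Multiplicative.ofAdd ((1, 0) : ℤ × ZMod 2))) = T →
        ψ (Monoid.PushoutI.of (φ := amalgMaps12) true
            (Multiplicative.ofAdd ((0, 1) : ℤ × ZMod 2))) = -1 →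
        ψ (Monoid.PushoutI.of (φ := amalgMaps12) false
            (Multiplicative.ofAdd (1 : ZMod 12))) = R →
        Function.Injective ψ) ∧
    Nonempty (Monoid.PushoutI amalgMaps12 ≃*
      (Subgroup.closure ({R, T} : Set (GL (Fin 4) ℤ)))) := by
  have h6 := pow_six_eq_neg_one hR
  have hinj {ψ : Monoid.PushoutI amalgMaps12 →* GL (Fin 4) ℤ} (hψr : ψ amalgR12 = R)
      (hψt : ψ amalgT12 = T) : Function.Injective ψ :=
    injective_of_map_eq hR hT amalgR12_pow_twelve commute_amalgR12_pow_six_amalgT12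
      closure_amalgR12_amalgT12 hψr hψt
  refine ⟨h6, orderOf_eq_twelve hR, Subgroup.subset_closure (by simp),
    ?_, fun ψ hψt _ hψr => hinj hψr hψt, ?_⟩
  · rw [← h6]
    exact pow_mem (Subgroup.subset_closure (Set.mem_singleton R)) 6
  obtain ⟨ψ, hψr, hψt⟩ := exists_amalg_hom (t := T) (r := R)
    (orderOf_eq_twelve hR ▸ pow_orderOf_eq_one R) (by rw [h6]; exact Commute.neg_one_left T)
  have hrange : ψ.range = Subgroup.closure {R, T} := by
    rw [MonoidHom.range_eq_map, ← closure_amalgR12_amalgT12, MonoidHom.map_closure,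
      Set.image_pair, hψr, hψt]
  exact ⟨(MonoidHom.ofInjective (hinj hψr hψt)).trans (MulEquiv.subgroupCongr hrange)⟩
end

section
/- Let R and T be the above 4×4 integer matrices with d = 16 and k = 8. Then the group homomorphism from the free group on two generators to GL(4, ℤ) sending the first generator to T and the second generator to R is injective; in particular the subgroup of GL(4, ℤ) generated by R and T is free of rank 2. -/
open scoped MatrixGroups

namespace FreeGroup

open scoped Pointwise

/-- A version of the ping-pong lemma for cyclic groups of infinite order, which does not require
the ping-pong sets to be split into attracting and repelling parts. -/
theorem injective_lift_of_zpow_ping_pong {ι G α : Type*} [Nontrivial ι] [Group G] [MulAction G α]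
    (a : ι → G) (X : ι → Set α) (hne : ∀ i, (X i).Nonempty)
    (hdisj : ∀ i j, i ≠ j → Disjoint (X i) (X j))
    (hpp : ∀ i j, i ≠ j → ∀ n : ℤ, n ≠ 0 → ∀ x ∈ X j, a i ^ n • x ∈ X i) :
    Function.Injective (FreeGroup.lift a) := by
  have hlift : FreeGroup.lift a =
      (Monoid.CoprodI.lift fun i => FreeGroup.lift fun _ : Unit => a i).comp
        (freeGroupEquivCoprodI (ι := ι)).toMonoidHom := by
    ext i
    simp
  rw [hlift, MonoidHom.coe_comp]
  refine Function.Injective.comp ?_ freeGroupEquivCoprodI.injective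
  refine Monoid.CoprodI.lift_injective_of_ping_pong
    (fun i => FreeGroup.lift fun _ : Unit => a i) ?_ X hne (fun i j => hdisj i j) ?_
  · inhabit ι
    refine Or.inr ⟨default, ?_⟩
    rw [FreeGroup.freeGroupUnitEquivInt.cardinal_eq, Cardinal.mk_denumerable]
    exact Cardinal.natCast_le_aleph0
  · intro i j hij
    refine FreeGroup.freeGroupUnitEquivInt.forall_congr_left.mpr fun n hn => ?_
    have hn0 : n ≠ 0 := by
      rintro rfl
      exact hn (by simp [FreeGroup.freeGroupUnitEquivInt])
    change FreeGroup.lift (fun _ => a i) (FreeGroup.of () ^ n) • X j ⊆ X i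
    simp only [map_zpow, FreeGroup.lift_apply_of]
    rintro _ ⟨x, hx, rfl⟩
    exact hpp i j hij n hn0 x hx

end FreeGroup

/-- A family of matrices indexed by `ℤ` which starts at the scalar `c` and satisfies the recursion
of the powers of `A` is `c` times the family of powers of `A`. -/
theorem Matrix.GeneralLinearGroup.smul_coe_zpow_eq {n S : Type*} [Fintype n] [DecidableEq n]
    [CommRing S] (A : GL n S) (c : S) (P : ℤ → Matrix n n S) (h0 : P 0 = c • 1)
    (hsucc : ∀ m, P (m + 1) = (A : Matrix n n S) * P m) (m : ℤ) :
    c • ((A ^ m : GL n S) : Matrix n n S) = P m := by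
  induction m using Int.induction_on with
  | zero => simp [h0]
  | succ m ih =>
    have h : A ^ ((m : ℤ) + 1) = A * A ^ (m : ℤ) := by group
    rw [hsucc, ← ih, h, Units.val_mul, Matrix.mul_smul]
  | pred m ih =>
    have h := hsucc (-(m : ℤ) - 1)
    rw [sub_add_cancel, ← ih] at h
    have h' : ((A⁻¹ : GL n S) : Matrix n n S) * A = 1 := by
      rw [← Units.val_mul, inv_mul_cancel, Units.val_one]
    calc c • ((A ^ (-(m : ℤ) - 1) : GL n S) : Matrix n n S)
        = ((A⁻¹ : GL n S) : Matrix n n S) * (c • ((A ^ (-(m : ℤ)) : GL n S) : Matrix n n S)) := by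
          have hA : A ^ (-(m : ℤ) - 1) = A⁻¹ * A ^ (-(m : ℤ)) := by group
          rw [hA, Units.val_mul, Matrix.mul_smul]
      _ = P (-(m : ℤ) - 1) := by rw [h, ← mul_assoc, h', one_mul]

namespace Monodromy

/-- An open polyhedral cone containing in its closure the fixed vector of `T`, and invariant under
`T⁻¹`. -/
def InCone (x : Fin 4 → ℤ) : Prop :=
  0 < x 0 ∧ 4 * x 0 + x 3 < 0 ∧ 0 < x 1 ∧ 0 < 4 * x 1 - 16 * x 0 - 3 * x 3 ∧
    0 < 4 * x 1 + x 2 - 8 * x 0 ∧ 0 < 4 * x 1 + x 2 - 40 * x 0 - 6 * x 3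

/-- The action of `T ^ n` on vectors. -/
def shear (n : ℤ) (x : Fin 4 → ℤ) : Fin 4 → ℤ := ![x 0, x 1 + n * x 3, x 2, x 3]

/-- An involution conjugating `T` to `T⁻¹` and `T⁻¹ * R` to its inverse. -/
def reflect (x : Fin 4 → ℤ) : Fin 4 → ℤ := ![x 0, -x 1, 16 * x 0 - x 2, x 3]

/-- The union of two cones between which the positive and the negative powers of `T` are
distributed. -/
def InTransvectionDomain (x : Fin 4 → ℤ) : Prop := InCone x ∨ InCone (reflect (shear (-1) x))

/-- The cone of vectors sent by `T` and `T⁻¹` to the two cones of `InTransvectionDomain`. -/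
def InUnipotentDomain (x : Fin 4 → ℤ) : Prop := InCone (shear (-1) x) ∧ InCone (reflect x)

/-- Six times the `m`-th power of the unipotent matrix `-R`. -/
def unipotentPow (m : ℤ) : Matrix (Fin 4) (Fin 4) ℤ :=
  !![6, 0, 0, 0; 0, 6, 0, 0; 0, 0, 6, 0; 0, 0, 0, 6] +
    (6 * m) • !![-2, -1, 0, 0; 0, 6, 1, -1; -16, -16, -2, 0; 0, 8, 1, -2] +
    (3 * m * (m - 1)) • !![4, -4, -1, 1; -16, 12, 3, -4; 64, -48, -12, 16; -16, 16, 4, -4] +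
    (m * (m - 1) * (m - 2)) • !![8, -4, -1, 2; -16, 8, 2, -4; 64, -32, -8, 16; -32, 16, 4, -8]

theorem unipotentPow_succ (m : ℤ) :
    unipotentPow (m + 1) =
      -!![1, 1, 0, 0; 0, -7, -1, 1; 16, 16, 1, 0; 0, -8, -1, 1] * unipotentPow m := by
  ext i j
  fin_cases i <;> fin_cases j <;>
    simp [unipotentPow, Matrix.mul_apply, Fin.sum_univ_four] <;> ring

theorem shear_neg (n : ℤ) (x : Fin 4 → ℤ) : shear n (-x) = -shear n x := by
  ext i
  fin_cases i <;> simp [shear, add_comm]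

theorem shear_reflect_eq (x : Fin 4 → ℤ) : shear 1 (reflect (reflect (shear (-1) x))) = x := by
  ext i
  fin_cases i <;> simp [shear, reflect]

theorem unipotentPow_mulVec_shear_reflect (m : ℤ) (x : Fin 4 → ℤ) :
    (unipotentPow m).mulVec (shear 1 (reflect x)) =
      shear 1 (reflect ((unipotentPow (-m)).mulVec x)) := by
  ext i
  fin_cases i <;>
    simp [unipotentPow, shear, reflect, Matrix.mulVec, dotProduct, Fin.sum_univ_four] <;>
    ring

theorem InUnipotentDomain.shear_reflect {x : Fin 4 → ℤ} (h : InUnipotentDomain x) :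
    InUnipotentDomain (shear 1 (reflect x)) := by
  have h1 : shear (-1) (shear 1 (reflect x)) = reflect x := by
    ext i
    fin_cases i <;> simp [shear, reflect]
  have h2 : reflect (shear 1 (reflect x)) = shear (-1) x := by
    ext i
    fin_cases i <;> simp [shear, reflect]
    ring
  exact ⟨by rw [h1]; exact h.2, by rw [h2]; exact h.1⟩

theorem InUnipotentDomain.of_smul {x : Fin 4 → ℤ} (h : InUnipotentDomain ((6 : ℤ) • x)) :
    InUnipotentDomain x := by
  simp [InUnipotentDomain, InCone, shear, reflect] at h ⊢
  omega

theorem InUnipotentDomain.shear {x : Fin 4 → ℤ} (h : InUnipotentDomain x) {n : ℤ} (hn : n ≠ 0) :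
    InTransvectionDomain (shear n x) := by
  simp [InUnipotentDomain, InTransvectionDomain, InCone, Monodromy.shear, reflect] at h ⊢
  rcases lt_or_gt_of_ne hn with hn | hn
  · have := mul_le_mul_of_nonpos_right (show n ≤ -1 by omega) (show x 3 ≤ 0 by omega)
    left
    omega
  · have := mul_le_mul_of_nonpos_right (show 1 ≤ n by omega) (show x 3 ≤ 0 by omega)
    right
    omega

/-- The inequalities defining the cone, multiplied by a nonnegative scalar. -/
theorem InCone.const_mul {x : Fin 4 → ℤ} (h : InCone x) {c : ℤ} (hc : 0 ≤ c) :
    0 ≤ c * x 0 ∧ c * (4 * x 0 + x 3) ≤ 0 ∧ 0 ≤ c * x 1 ∧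
      0 ≤ c * (4 * x 1 - 16 * x 0 - 3 * x 3) ∧ 0 ≤ c * (4 * x 1 + x 2 - 8 * x 0) ∧
      0 ≤ c * (4 * x 1 + x 2 - 40 * x 0 - 6 * x 3) := by
  obtain ⟨h0, h1, h2, h3, h4, h5⟩ := h
  exact ⟨mul_nonneg hc h0.le, mul_nonpos_of_nonneg_of_nonpos hc h1.le,
    mul_nonneg hc h2.le, mul_nonneg hc h3.le, mul_nonneg hc h4.le,
    mul_nonneg hc h5.le⟩

theorem InCone.neg_unipotentPow {x : Fin 4 → ℤ} (h : InCone x) {m : ℤ} (hm : 0 < m) :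
    InUnipotentDomain (-(unipotentPow m).mulVec x) := by
  obtain ⟨q, hq, rfl⟩ : ∃ q : ℤ, 0 ≤ q ∧ m = q + 1 := ⟨m - 1, by omega, by omega⟩
  obtain ⟨a0, a1, a2, a3, a4, a5⟩ := h.const_mul hq
  obtain ⟨b0, b1, b2, b3, b4, b5⟩ := h.const_mul (pow_nonneg hq 2)
  obtain ⟨c0, c1, c2, c3, c4, c5⟩ := h.const_mul (pow_nonneg hq 3)
  obtain ⟨d0, d1, d2, d3, d4, d5⟩ := h.const_mul (mul_nonneg hq (sq_nonneg (q - 1)))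
  obtain ⟨h0, h1, h2, h3, h4, h5⟩ := h
  simp [InUnipotentDomain, InCone, shear, reflect, unipotentPow, dotProduct, Fin.sum_univ_four]
  refine ⟨⟨?_, ?_, ?_, ?_, ?_, ?_⟩, ?_, ?_, ?_, ?_, ?_, ?_⟩ <;> linarith

theorem InCone.unipotentPow_neg {x : Fin 4 → ℤ} (h : InCone x) {m : ℤ} (hm : 0 < m) :
    InUnipotentDomain ((unipotentPow (-m)).mulVec x) := by
  obtain ⟨q, hq, rfl⟩ : ∃ q : ℤ, 0 ≤ q ∧ m = q + 1 := ⟨m - 1, by omega, by omega⟩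
  obtain ⟨a0, a1, a2, a3, a4, a5⟩ := h.const_mul hq
  obtain ⟨b0, b1, b2, b3, b4, b5⟩ := h.const_mul (pow_nonneg hq 2)
  obtain ⟨c0, c1, c2, c3, c4, c5⟩ := h.const_mul (pow_nonneg hq 3)
  obtain ⟨h0, h1, h2, h3, h4, h5⟩ := h
  simp [InUnipotentDomain, InCone, shear, reflect, unipotentPow, dotProduct, Fin.sum_univ_four]
  refine ⟨⟨?_, ?_, ?_, ?_, ?_, ?_⟩, ?_, ?_, ?_, ?_, ?_, ?_⟩ <;> linarith

theorem InTransvectionDomain.unipotentPow {x : Fin 4 → ℤ} (h : InTransvectionDomain x) {m : ℤ}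
    (hm : m ≠ 0) : InUnipotentDomain ((unipotentPow m).mulVec x) ∨
      InUnipotentDomain (-(unipotentPow m).mulVec x) := by
  have key : ∀ {y : Fin 4 → ℤ}, InCone y → ∀ {k : ℤ}, k ≠ 0 →
      InUnipotentDomain ((Monodromy.unipotentPow k).mulVec y) ∨
        InUnipotentDomain (-(Monodromy.unipotentPow k).mulVec y) := by
    intro y hy k hk
    rcases lt_or_gt_of_ne hk with hk | hk
    · exact Or.inl (by simpa using hy.unipotentPow_neg (neg_pos.mpr hk))
    · exact Or.inr (hy.neg_unipotentPow hk)
  rcases h with h | h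
  · exact key h hm
  · rw [← shear_reflect_eq x, unipotentPow_mulVec_shear_reflect]
    refine (key h (neg_ne_zero.mpr hm)).imp InUnipotentDomain.shear_reflect fun h' => ?_
    convert h'.shear_reflect using 1
    ext i
    fin_cases i <;> simp [Monodromy.shear, reflect] <;> ring

/-- The ping-pong sets of `T` and of `R`. -/
def pingPongSet : Fin 2 → Set (Fin 4 → ℤ) :=
  ![{x | InTransvectionDomain x ∨ InTransvectionDomain (-x)},
    {x | InUnipotentDomain x ∨ InUnipotentDomain (-x)}]

theorem pingPongSet_nonempty (i : Fin 2) : (pingPongSet i).Nonempty := by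
  have h : InCone ![1, 1, 100, -5] := by simp [InCone]
  fin_cases i
  · exact ⟨_, Or.inl (Or.inl h)⟩
  · exact ⟨_, Or.inl (h.neg_unipotentPow one_pos)⟩

theorem disjoint_pingPongSet : Disjoint (pingPongSet 0) (pingPongSet 1) := by
  rw [Set.disjoint_left]
  intro x hx hx'
  simp [pingPongSet, InTransvectionDomain, InUnipotentDomain, InCone, shear, reflect] at hx hx'
  omega

theorem zpow_smul_eq_shear {T : GL (Fin 4) ℤ}
    (hT : (T : Matrix (Fin 4) (Fin 4) ℤ) =
      !![1, 0, 0, 0; 0, 1, 0, 1; 0, 0, 1, 0; 0, 0, 0, 1]) (n : ℤ) (x : Fin 4 → ℤ) :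
    T ^ n • x = shear n x := by
  have h := T.smul_coe_zpow_eq 1 (fun m => !![1, 0, 0, 0; 0, 1, 0, m; 0, 0, 1, 0; 0, 0, 0, 1])
    (by ext i j; fin_cases i <;> fin_cases j <;> simp)
    (fun m => by
      rw [hT]
      ext i j
      fin_cases i <;> fin_cases j <;> simp [Matrix.mul_apply, Fin.sum_univ_four]) n
  rw [one_smul] at h
  rw [Units.smul_def, Matrix.smul_eq_mulVec, h]
  ext i
  fin_cases i <;> simp [shear, Matrix.mulVec, dotProduct, Fin.sum_univ_four]

theorem smul_zpow_smul_eq {R : GL (Fin 4) ℤ}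
    (hR : (R : Matrix (Fin 4) (Fin 4) ℤ) =
      !![1, 1, 0, 0; 0, -7, -1, 1; 16, 16, 1, 0; 0, -8, -1, 1]) (m : ℤ) (x : Fin 4 → ℤ) :
    (6 : ℤ) • (R ^ m • x) = (unipotentPow m).mulVec x ∨
      (6 : ℤ) • (R ^ m • x) = -(unipotentPow m).mulVec x := by
  have h := (-R).smul_coe_zpow_eq 6 unipotentPow
    (by ext i j; fin_cases i <;> fin_cases j <;> simp [unipotentPow])
    (fun m => by rw [unipotentPow_succ, Units.val_neg, hR]) m
  rw [← h, Matrix.smul_mulVec, Units.smul_def, Matrix.smul_eq_mulVec]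
  rcases Int.even_or_odd m with hm | hm
  · exact Or.inl (by rw [hm.neg_zpow])
  · exact Or.inr (by rw [hm.neg_zpow, Units.val_neg, Matrix.neg_mulVec, smul_neg, neg_neg])

theorem zpow_smul_mem_pingPongSet_zero {T : GL (Fin 4) ℤ}
    (hT : (T : Matrix (Fin 4) (Fin 4) ℤ) =
      !![1, 0, 0, 0; 0, 1, 0, 1; 0, 0, 1, 0; 0, 0, 0, 1]) {n : ℤ} (hn : n ≠ 0)
    {x : Fin 4 → ℤ} (hx : x ∈ pingPongSet 1) : T ^ n • x ∈ pingPongSet 0 := by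
  rw [zpow_smul_eq_shear hT]
  exact hx.imp (·.shear hn) fun h => shear_neg n x ▸ h.shear hn

theorem zpow_smul_mem_pingPongSet_one {R : GL (Fin 4) ℤ}
    (hR : (R : Matrix (Fin 4) (Fin 4) ℤ) =
      !![1, 1, 0, 0; 0, -7, -1, 1; 16, 16, 1, 0; 0, -8, -1, 1]) {n : ℤ} (hn : n ≠ 0)
    {x : Fin 4 → ℤ} (hx : x ∈ pingPongSet 0) : R ^ n • x ∈ pingPongSet 1 := by
  have h : InUnipotentDomain ((unipotentPow n).mulVec x) ∨
      InUnipotentDomain (-(unipotentPow n).mulVec x) := by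
    rcases hx with hx | hx
    · exact hx.unipotentPow hn
    · simpa [Matrix.mulVec_neg, or_comm] using hx.unipotentPow hn
  suffices InUnipotentDomain ((6 : ℤ) • (R ^ n • x)) ∨
      InUnipotentDomain (-((6 : ℤ) • (R ^ n • x))) from
    this.imp (·.of_smul) fun h' => (smul_neg (6 : ℤ) (R ^ n • x) ▸ h').of_smul
  rcases smul_zpow_smul_eq hR n x with h' | h' <;> rw [h']
  · exact h
  · rw [neg_neg]
    exact h.symm

end Monodromy

/-- For `d = 16`, `k = 8`, the hypergeometric matrices `R = T·U` and `T`
generate a free group of rank 2: the homomorphism from the free group on two generators to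
`GL(4,ℤ)` sending the first generator to `T` and the second to `R` is injective, and
consequently the subgroup of `GL(4,ℤ)` generated by `R` and `T` is free of rank 2. -/
theorem monodromy_free_of_rank_two_d16_k8
    (R T : GL (Fin 4) ℤ)
    (hR : (R : Matrix (Fin 4) (Fin 4) ℤ) =
      !![1, 1, 0, 0; 0, -7, -1, 1; 16, 16, 1, 0; 0, -8, -1, 1])
    (hT : (T : Matrix (Fin 4) (Fin 4) ℤ) =
      !![1, 0, 0, 0; 0, 1, 0, 1; 0, 0, 1, 0; 0, 0, 0, 1]) :
    Function.Injective (FreeGroup.lift ![T, R] : FreeGroup (Fin 2) →* GL (Fin 4) ℤ) ∧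
    Nonempty (FreeGroup (Fin 2) ≃* (Subgroup.closure ({R, T} : Set (GL (Fin 4) ℤ)))) := by
  have hinj : Function.Injective (FreeGroup.lift ![T, R] : FreeGroup (Fin 2) →* GL (Fin 4) ℤ) := by
    refine FreeGroup.injective_lift_of_zpow_ping_pong ![T, R] Monodromy.pingPongSet
      Monodromy.pingPongSet_nonempty ?_ ?_
    · intro i j hij
      fin_cases i <;> fin_cases j <;> first | exact absurd rfl hij | skip
      · exact Monodromy.disjoint_pingPongSet
      · exact Monodromy.disjoint_pingPongSet.symm
    · intro i j hij n hn x hx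
      fin_cases i <;> fin_cases j <;> first | exact absurd rfl hij | skip
      · exact Monodromy.zpow_smul_mem_pingPongSet_zero hT hn hx
      · exact Monodromy.zpow_smul_mem_pingPongSet_one hR hn hx
  refine ⟨hinj, ⟨(MonoidHom.ofInjective hinj).trans (MulEquiv.subgroupCongr ?_)⟩⟩
  rw [FreeGroup.range_lift_eq_closure, Matrix.range_cons, Matrix.range_cons, Matrix.range_empty,
    Set.union_empty, Set.union_comm, Set.singleton_union]
end

section
/- Let R and T be the above 4×4 integer matrices with d = 12 and k = 7. Then the group homomorphism from the free group on two generators to GL(4, ℤ) sending the first generator to T and the second generator to R is injective; in particular the subgroup of GL(4, ℤ) generated by R and T is free of rank 2. -/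
open scoped MatrixGroups

open scoped Pointwise in
theorem zpow_smul_subset_union {G α : Type*} [Group G] [MulAction G α] {g : G} {S A B : Set α}
    (hSA : g • S ⊆ A) (hA : g • A ⊆ A) (hSB : g⁻¹ • S ⊆ B) (hB : g⁻¹ • B ⊆ B)
    {n : ℤ} (hn : n ≠ 0) : g ^ n • S ⊆ A ∪ B := by
  have key : ∀ {g : G} {A : Set α}, g • S ⊆ A → g • A ⊆ A → ∀ n : ℕ, g ^ (n + 1) • S ⊆ A := by
    intro g A hS hA n
    induction n with
    | zero => simpa using hS
    | succ n ih =>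
      rw [pow_succ', mul_smul]
      exact (Set.smul_set_mono ih).trans hA
  obtain ⟨m, rfl | rfl⟩ := n.eq_nat_or_neg
  · obtain ⟨m, rfl⟩ := Nat.exists_eq_succ_of_ne_zero (n := m) (by simpa using hn)
    rw [zpow_natCast]
    exact (key hSA hA m).trans Set.subset_union_left
  · obtain ⟨m, rfl⟩ := Nat.exists_eq_succ_of_ne_zero (n := m) (by simpa using hn)
    rw [zpow_neg, zpow_natCast, ← inv_pow]
    exact (key hSB hB m).trans Set.subset_union_right

open scoped Pointwise Function in
/-- Ping-pong for a free group where each generator `a i` maps its attracting set `X i` and the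
ping-pong sets of the other generators into `X i`, and `(a i)⁻¹` does the same for `Y i`. -/
theorem FreeGroup.injective_lift_of_ping_pong_smul_subset {ι G α : Type*} [Nontrivial ι]
    [Group G] [MulAction G α] (a : ι → G) (X Y : ι → Set α)
    (hne : ∀ i, (X i ∪ Y i).Nonempty)
    (hdisj : Pairwise (Disjoint on fun i => X i ∪ Y i))
    (hX : ∀ i, a i • X i ⊆ X i) (hY : ∀ i, (a i)⁻¹ • Y i ⊆ Y i)
    (hXY : Pairwise fun i j => a i • (X j ∪ Y j) ⊆ X i)
    (hYX : Pairwise fun i j => (a i)⁻¹ • (X j ∪ Y j) ⊆ Y i) :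
    Function.Injective (FreeGroup.lift a) := by
  have hlift : FreeGroup.lift a =
      (Monoid.CoprodI.lift fun i => FreeGroup.lift fun _ : Unit => a i).comp
        (freeGroupEquivCoprodI (ι := ι)).toMonoidHom := by
    ext i
    simp
  rw [hlift, MonoidHom.coe_comp]
  refine Function.Injective.comp ?_ freeGroupEquivCoprodI.injective
  refine Monoid.CoprodI.lift_injective_of_ping_pong
    (fun i => FreeGroup.lift fun _ : Unit => a i) ?_ (fun i => X i ∪ Y i) hne hdisj ?_
  · obtain ⟨i⟩ : Nonempty ι := inferInstance
    refine Or.inr ⟨i, ?_⟩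
    have : Infinite (FreeGroup Unit) := FreeGroup.freeGroupUnitEquivInt.infinite_iff.2 inferInstance
    exact (Cardinal.natCast_lt_aleph0 (n := 3)).le.trans (Cardinal.aleph0_le_mk _)
  · intro i j hij h hh
    obtain ⟨n, rfl⟩ := FreeGroup.freeGroupUnitEquivInt.symm.surjective h
    have hn : n ≠ 0 := by
      rintro rfl
      exact hh rfl
    have hpow : FreeGroup.lift (fun _ : Unit => a i) (FreeGroup.freeGroupUnitEquivInt.symm n) =
        a i ^ n := by
      simp [FreeGroup.freeGroupUnitEquivInt]
    rw [hpow]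
    exact zpow_smul_subset_union (hXY hij) (hX i) (hYX hij) (hY i) hn

/-- Attracting cone of the positive powers of `T`. -/
def coneT : Set (Fin 4 → ℤ) :=
  {v | 0 < -24 * v 0 + 5 * v 1 + 4 * v 2 - 5 * v 3 ∧
    0 < -4 * v 0 + 5 * v 1 + 4 * v 2 - v 3 ∧
    0 < -v 0 ∧
    0 < v 1 - v 3 ∧
    0 < 19 * v 0 + 5 * v 3 ∧
    0 < 20 * v 0 + 3 * v 1 + v 3}

/-- Attracting cone of the negative powers of `T`. -/
def coneTInv : Set (Fin 4 → ℤ) :=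
  {v | 0 < -v 0 ∧
    0 < -v 1 ∧
    0 < 19 * v 0 + 5 * v 3 ∧
    0 < 20 * v 0 - 3 * v 1 + 4 * v 3 ∧
    0 < 24 * v 0 - 5 * v 1 - 4 * v 2 ∧
    0 < 44 * v 0 - 5 * v 1 - 4 * v 2 + 4 * v 3}

/-- Attracting cone, up to sign, of the positive powers of `R`. -/
def coneR : Set (Fin 4 → ℤ) :=
  {v | 0 < -14 * v 0 + 7 * v 1 + 2 * v 2 - 4 * v 3 ∧
    0 < -10 * v 0 + 4 * v 1 + v 2 - 3 * v 3 ∧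
    0 < -10 * v 0 + 7 * v 1 + 2 * v 2 - 3 * v 3 ∧
    0 < -7 * v 0 + v 1 + v 2 ∧
    0 < -2 * v 0 + v 1 - v 3 ∧
    0 < -2 * v 0 + 4 * v 1 + v 2 - v 3 ∧
    0 < -v 1 + v 3 ∧
    0 < 2 * v 0 + v 1 ∧
    0 < 15 * v 0 - 5 * v 1 - v 2 + 5 * v 3 ∧
    0 < 65 * v 0 - 27 * v 1 - 3 * v 2 + 28 * v 3 ∧
    0 < 89 * v 0 - 25 * v 1 - 7 * v 2 + 25 * v 3}

/-- Attracting cone, up to sign, of the negative powers of `R`. -/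
def coneRInv : Set (Fin 4 → ℤ) :=
  {v | 0 < -2 * v 0 - v 1 ∧
    0 < v 1 ∧
    0 < 2 * v 0 - 4 * v 1 - v 2 + v 3 ∧
    0 < 2 * v 0 - v 1 + v 3 ∧
    0 < 3 * v 0 + 5 * v 1 + v 2 ∧
    0 < 5 * v 0 - v 1 - v 2 + v 3 ∧
    0 < 5 * v 0 + 25 * v 1 + 7 * v 2 ∧
    0 < 10 * v 0 - 7 * v 1 - 2 * v 2 + 3 * v 3 ∧
    0 < 10 * v 0 - 4 * v 1 - v 2 + 3 * v 3 ∧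
    0 < 14 * v 0 - 7 * v 1 - 2 * v 2 + 4 * v 3 ∧
    0 < 29 * v 0 + 27 * v 1 + 3 * v 2 + v 3}

/-- Matrices whose first column lies in `C` or in `-C`. -/
def colMem (C : Set (Fin 4 → ℤ)) : Set (Matrix (Fin 4) (Fin 4) ℤ) :=
  {M | M.col 0 ∈ C ∨ -M.col 0 ∈ C}

open scoped Pointwise in
theorem smul_colMem_subset {g : GL (Fin 4) ℤ} {A : Matrix (Fin 4) (Fin 4) ℤ}
    (hg : (g : Matrix (Fin 4) (Fin 4) ℤ) = A) {C D : Set (Fin 4 → ℤ)}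
    (h : (∀ v ∈ C, A.mulVec v ∈ D) ∨ ∀ v ∈ C, -A.mulVec v ∈ D) :
    g • colMem C ⊆ colMem D := by
  rintro _ ⟨M, hM, rfl⟩
  have hcol : (g • M).col 0 = A.mulVec (M.col 0) := by
    subst hg
    rfl
  have hneg := Matrix.mulVec_neg (M.col 0) A
  change (g • M).col 0 ∈ D ∨ -(g • M).col 0 ∈ D
  rw [hcol]
  rcases h with h | h <;> rcases hM with hM | hM
  · exact Or.inl (h _ hM)
  · exact Or.inr (hneg ▸ h _ hM)
  · exact Or.inr (h _ hM)
  · exact Or.inl (by simpa only [hneg, neg_neg] using h _ hM)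

theorem colMem_nonempty {C : Set (Fin 4 → ℤ)} (hC : C.Nonempty) : (colMem C).Nonempty := by
  obtain ⟨v, hv⟩ := hC
  exact ⟨Matrix.of fun i _ => v i, Or.inl hv⟩

theorem disjoint_colMem {C D : Set (Fin 4 → ℤ)} (h : Disjoint C D)
    (hneg : ∀ v ∈ C, -v ∉ D) : Disjoint (colMem C) (colMem D) := by
  rw [Set.disjoint_left] at h ⊢
  rintro M (hC | hC) (hD | hD)
  · exact h hC hD
  · exact hneg _ hC hD
  · exact hneg _ hC (by simpa only [neg_neg] using hD)
  · exact h hC hD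

/-- The cones attracting `T` and the cones attracting `R` are separated by the inequalities
`0 < v 1 < v 3`. -/
theorem disjoint_colMem_coneT_coneR :
    Disjoint (colMem coneT ∪ colMem coneTInv) (colMem coneR ∪ colMem coneRInv) := by
  simp only [Set.disjoint_union_left, Set.disjoint_union_right]
  refine ⟨⟨?_, ?_⟩, ?_, ?_⟩ <;>
    refine disjoint_colMem (Set.disjoint_left.2 fun v hC hD => ?_) fun v hC hD => ?_
  all_goals
    simp only [coneT, coneTInv, coneR, coneRInv, Set.mem_ofPred_eq, Pi.neg_apply] at hC hD
    casesm* _ ∧ _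
    linarith

open scoped Pointwise in
theorem smul_colMem_cone_subset
    {R T : GL (Fin 4) ℤ}
    (hR : (R : Matrix (Fin 4) (Fin 4) ℤ) =
      !![1, 1, 0, 0; 0, -6, -1, 1; 12, 12, 1, 0; 0, -7, -1, 1])
    (hT : (T : Matrix (Fin 4) (Fin 4) ℤ) =
      !![1, 0, 0, 0; 0, 1, 0, 1; 0, 0, 1, 0; 0, 0, 0, 1]) :
    (T • colMem coneT ⊆ colMem coneT ∧ T • colMem coneR ⊆ colMem coneT ∧
      T • colMem coneRInv ⊆ colMem coneT) ∧
    (T⁻¹ • colMem coneTInv ⊆ colMem coneTInv ∧ T⁻¹ • colMem coneR ⊆ colMem coneTInv ∧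
      T⁻¹ • colMem coneRInv ⊆ colMem coneTInv) ∧
    (R • colMem coneR ⊆ colMem coneR ∧ R • colMem coneT ⊆ colMem coneR ∧
      R • colMem coneTInv ⊆ colMem coneR) ∧
    R⁻¹ • colMem coneRInv ⊆ colMem coneRInv ∧ R⁻¹ • colMem coneT ⊆ colMem coneRInv ∧
      R⁻¹ • colMem coneTInv ⊆ colMem coneRInv := by
  have hT' : ((T⁻¹ : GL (Fin 4) ℤ) : Matrix (Fin 4) (Fin 4) ℤ) =
      !![1, 0, 0, 0; 0, 1, 0, -1; 0, 0, 1, 0; 0, 0, 0, 1] :=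
    Units.inv_eq_of_mul_eq_one_right (by rw [hT]; decide)
  have hR' : ((R⁻¹ : GL (Fin 4) ℤ) : Matrix (Fin 4) (Fin 4) ℤ) =
      !![1, -1, 0, 1; 0, 1, 0, -1; -12, 0, 1, 0; -12, 7, 1, -6] :=
    Units.inv_eq_of_mul_eq_one_right (by rw [hR]; decide)
  refine ⟨⟨smul_colMem_subset hT (Or.inl ?_), smul_colMem_subset hT (Or.inl ?_),
      smul_colMem_subset hT (Or.inl ?_)⟩,
    ⟨smul_colMem_subset hT' (Or.inl ?_), smul_colMem_subset hT' (Or.inl ?_),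
      smul_colMem_subset hT' (Or.inl ?_)⟩,
    ⟨smul_colMem_subset hR (Or.inr ?_), smul_colMem_subset hR (Or.inr ?_),
      smul_colMem_subset hR (Or.inl ?_)⟩,
    smul_colMem_subset hR' (Or.inr ?_), smul_colMem_subset hR' (Or.inl ?_),
      smul_colMem_subset hR' (Or.inr ?_)⟩
  all_goals
    intro v hv
    simp only [coneT, coneTInv, coneR, coneRInv, Set.mem_ofPred_eq] at hv
    simp [coneT, coneTInv, coneR, coneRInv, dotProduct, Fin.sum_univ_four]
    casesm* _ ∧ _
    and_intros <;> linarith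

/-- For `d = 12`, `k = 7`, the hypergeometric matrices `R = T·U` and `T`
generate a free group of rank 2: the homomorphism from the free group on two generators to
`GL(4,ℤ)` sending the first generator to `T` and the second to `R` is injective, and
consequently the subgroup of `GL(4,ℤ)` generated by `R` and `T` is free of rank 2. -/
theorem monodromy_free_of_rank_two_d12_k7
    (R T : GL (Fin 4) ℤ)
    (hR : (R : Matrix (Fin 4) (Fin 4) ℤ) =
      !![1, 1, 0, 0; 0, -6, -1, 1; 12, 12, 1, 0; 0, -7, -1, 1])
    (hT : (T : Matrix (Fin 4) (Fin 4) ℤ) =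
      !![1, 0, 0, 0; 0, 1, 0, 1; 0, 0, 1, 0; 0, 0, 0, 1]) :
    Function.Injective (FreeGroup.lift ![T, R] : FreeGroup (Fin 2) →* GL (Fin 4) ℤ) ∧
    Nonempty (FreeGroup (Fin 2) ≃* (Subgroup.closure ({R, T} : Set (GL (Fin 4) ℤ)))) := by
  obtain ⟨⟨hTT, hTR, hTR'⟩, ⟨hTT', hTiR, hTiR'⟩, ⟨hRR, hRT, hRT'⟩, hRR', hRiT, hRiT'⟩ :=
    smul_colMem_cone_subset hR hT
  have hinj : Function.Injective (FreeGroup.lift ![T, R]) := by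
    refine FreeGroup.injective_lift_of_ping_pong_smul_subset (α := Matrix (Fin 4) (Fin 4) ℤ)
      ![T, R] ![colMem coneT, colMem coneR] ![colMem coneTInv, colMem coneRInv] ?_ ?_ ?_ ?_ ?_ ?_
    · rw [Fin.forall_fin_two]
      exact ⟨(colMem_nonempty ⟨![-1, 6, 0, 4], by simp [coneT]⟩).inl,
        (colMem_nonempty ⟨![-1, 5, -11, 6], by simp [coneR]⟩).inl⟩
    · intro i j hij
      fin_cases i <;> fin_cases j
      · exact absurd rfl hij
      · exact disjoint_colMem_coneT_coneR
      · exact disjoint_colMem_coneT_coneR.symm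
      · exact absurd rfl hij
    · exact Fin.forall_fin_two.2 ⟨hTT, hRR⟩
    · exact Fin.forall_fin_two.2 ⟨hTT', hRR'⟩
    · intro i j hij
      fin_cases i <;> fin_cases j
      · exact absurd rfl hij
      · exact (Set.smul_set_union).trans_subset (Set.union_subset hTR hTR')
      · exact (Set.smul_set_union).trans_subset (Set.union_subset hRT hRT')
      · exact absurd rfl hij
    · intro i j hij
      fin_cases i <;> fin_cases j
      · exact absurd rfl hij
      · exact (Set.smul_set_union).trans_subset (Set.union_subset hTiR hTiR')
      · exact (Set.smul_set_union).trans_subset (Set.union_subset hRiT hRiT')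
      · exact absurd rfl hij
  refine ⟨hinj, ⟨(MonoidHom.ofInjective hinj).trans (MulEquiv.subgroupCongr ?_)⟩⟩
  rw [FreeGroup.range_lift_eq_closure, Matrix.range_cons_cons_empty, Set.pair_comm]
end

section
/- Let R and T be the above 4×4 integer matrices with d = 8 and k = 6. Then the group homomorphism from the free group on two generators to GL(4, ℤ) sending the first generator to T and the second generator to R is injective; in particular the subgroup of GL(4, ℤ) generated by R and T is free of rank 2. -/
open scoped MatrixGroups

open scoped Pointwise in
/-- A group homomorphism out of a free group is injective as soon as all nontrivial powers of the
generators play ping-pong. -/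
theorem injective_freeGroup_lift_of_zpow_ping_pong {ι G α : Type} [Nontrivial ι] [Group G]
    [MulAction G α] (a : ι → G) (X : ι → Set α) (hne : ∀ i, (X i).Nonempty)
    (hdisj : Pairwise (Function.onFun Disjoint X))
    (h : ∀ i j, i ≠ j → ∀ n : ℤ, n ≠ 0 → ∀ x ∈ X j, a i ^ n • x ∈ X i) :
    Function.Injective (FreeGroup.lift a) := by
  have hlift : FreeGroup.lift a =
      (Monoid.CoprodI.lift fun i => FreeGroup.lift fun _ : Unit => a i).comp
        (freeGroupEquivCoprodI (ι := ι)).toMonoidHom := by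
    ext i
    simp
  rw [hlift, MonoidHom.coe_comp]
  refine Function.Injective.comp ?_ (MulEquiv.injective freeGroupEquivCoprodI)
  refine Monoid.CoprodI.lift_injective_of_ping_pong _ ?_ X hne hdisj ?_
  · refine Or.inr ⟨Classical.arbitrary ι, ?_⟩
    rw [FreeGroup.freeGroupUnitEquivInt.cardinal_eq, Cardinal.mk_denumerable]
    exact Cardinal.natCast_le_aleph0
  · intro i j hij
    refine FreeGroup.freeGroupUnitEquivInt.forall_congr_left.mpr fun n hn => ?_
    have hn0 : n ≠ 0 := by
      rintro rfl
      exact hn (by simp [FreeGroup.freeGroupUnitEquivInt])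
    change FreeGroup.lift (fun _ => a i) (FreeGroup.of () ^ n) • X j ⊆ X i
    rw [map_zpow, FreeGroup.lift_apply_of]
    rintro _ ⟨x, hx, rfl⟩
    exact h i j hij n hn0 x hx

namespace HypergeometricMonodromy

/-- The matrix `T`. -/
def matT : GL (Fin 4) ℤ where
  val := !![1, 0, 0, 0; 0, 1, 0, 1; 0, 0, 1, 0; 0, 0, 0, 1]
  inv := !![1, 0, 0, 0; 0, 1, 0, -1; 0, 0, 1, 0; 0, 0, 0, 1]
  val_inv := by decide
  inv_val := by decide

/-- The matrix `R` for `d = 8` and `k = 6`. -/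
def matR : GL (Fin 4) ℤ where
  val := !![1, 1, 0, 0; 0, -5, -1, 1; 8, 8, 1, 0; 0, -6, -1, 1]
  inv := !![1, -1, 0, 1; 0, 1, 0, -1; -8, 0, 1, 0; -8, 6, 1, -5]
  val_inv := by decide
  inv_val := by decide

/-- An involution which inverts both `R` and `T` by conjugation. -/
def matE : GL (Fin 4) ℤ where
  val := !![-1, 0, 0, 0; 0, 1, 0, -1; -8, 0, 1, 0; 0, 0, 0, -1]
  inv := !![-1, 0, 0, 0; 0, 1, 0, -1; -8, 0, 1, 0; 0, 0, 0, -1]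
  val_inv := by decide
  inv_val := by decide

theorem matT_inv_smul (v : Fin 4 → ℤ) : matT⁻¹ • v = ![v 0, v 1 - v 3, v 2, v 3] := by
  ext i
  fin_cases i <;>
    simp [matT, Units.smul_def, Matrix.mulVec, dotProduct, Fin.sum_univ_four]
  ring

theorem matR_smul (v : Fin 4 → ℤ) :
    matR • v = ![v 0 + v 1, -5 * v 1 - v 2 + v 3, 8 * v 0 + 8 * v 1 + v 2,
      -6 * v 1 - v 2 + v 3] := by
  ext i
  fin_cases i <;>
    simp [matR, Units.smul_def, Matrix.mulVec, dotProduct, Fin.sum_univ_four] <;> ring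

theorem matR_inv_smul (v : Fin 4 → ℤ) :
    matR⁻¹ • v = ![v 0 - v 1 + v 3, v 1 - v 3, -8 * v 0 + v 2,
      -8 * v 0 + 6 * v 1 + v 2 - 5 * v 3] := by
  ext i
  fin_cases i <;>
    simp [matR, Units.smul_def, Matrix.mulVec, dotProduct, Fin.sum_univ_four] <;> ring

theorem matE_smul (v : Fin 4 → ℤ) :
    matE • v = ![-v 0, v 1 - v 3, -8 * v 0 + v 2, -v 3] := by
  ext i
  fin_cases i <;>
    simp [matE, Units.smul_def, Matrix.mulVec, dotProduct, Fin.sum_univ_four]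
  ring

theorem matT_smul (v : Fin 4 → ℤ) : matT • v = ![v 0, v 1 + v 3, v 2, v 3] := by
  ext i
  fin_cases i <;> simp [matT, Units.smul_def, Matrix.mulVec, dotProduct, Fin.sum_univ_four]

theorem matT_zpow_smul (n : ℤ) (v : Fin 4 → ℤ) :
    matT ^ n • v = ![v 0, v 1 + n * v 3, v 2, v 3] := by
  induction n generalizing v with
  | zero => ext i; fin_cases i <;> simp
  | succ n ih =>
    rw [zpow_add_one, mul_smul, ih, matT_smul]
    ext i; fin_cases i <;> simp; ring
  | pred n ih =>
    rw [zpow_sub_one, mul_smul, ih, matT_inv_smul]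
    ext i; fin_cases i <;> simp; ring

theorem matE_inv : matE⁻¹ = matE := rfl

theorem matE_smul_matE_smul (v : Fin 4 → ℤ) : matE • matE • v = v :=
  inv_smul_smul matE v

theorem matE_conj_matR : matE * matR * matE⁻¹ = matR⁻¹ :=
  Units.ext (by decide)

theorem matE_conj_matT : matE * matT * matE⁻¹ = matT⁻¹ :=
  Units.ext (by decide)

theorem zpow_smul_matE_smul {g : GL (Fin 4) ℤ} (hg : matE * g * matE⁻¹ = g⁻¹) (n : ℤ)
    (v : Fin 4 → ℤ) : g ^ n • matE • v = matE • g ^ (-n) • v := by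
  rw [zpow_neg, ← inv_zpow, ← hg, conj_zpow, mul_smul, mul_smul, matE_smul_matE_smul, matE_inv]

/-- The open polyhedral cone from which the ping-pong sets are built. -/
def InCone (v : Fin 4 → ℤ) : Prop :=
  0 < v 0 ∧
  0 < v 1 ∧
  0 < 21 * v 0 - 10 * v 2 - 14 * v 3 ∧
  0 < -19 * v 0 + 11 * v 1 - 8 * v 2 - 17 * v 3 ∧
  0 < -35 * v 0 + 14 * v 1 + 16 * v 2 ∧
  0 < 47 * v 0 - 10 * v 2 - 10 * v 3 ∧
  0 < -58 * v 0 + 15 * v 2 - 17 * v 3 ∧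
  0 < -58 * v 0 + 17 * v 1 + 15 * v 2 ∧
  0 < -9 * v 0 - 31 * v 2 - 59 * v 3 ∧
  0 < -80 * v 0 + 27 * v 1 + 10 * v 2 ∧
  0 < -86 * v 0 + 9 * v 2 - 23 * v 3 ∧
  0 < -80 * v 0 + 23 * v 1 + 18 * v 2 ∧
  0 < -15 * v 0 + 28 * v 1 - 30 * v 2 - 54 * v 3 ∧
  0 < -91 * v 0 + 26 * v 2 - 28 * v 3 ∧
  0 < -297 * v 0 + v 2 - 91 * v 3 ∧
  0 < -180 * v 0 + 115 * v 1 - 87 * v 2 - 180 * v 3 ∧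
  0 < -1880 * v 0 + 847 * v 1 - 175 * v 2 - 640 * v 3 ∧
  0 < -4785 * v 0 + 1419 * v 1 + 470 * v 2 - 200 * v 3

/-- A cone which `matR ^ n` reaches from `InCone` up to sign, for every `n ≠ 0`. -/
def InSlab (v : Fin 4 → ℤ) : Prop :=
  InCone (matT⁻¹ • v) ∧ InCone (-(matT⁻¹ • matE • v))

/-- The linear form satisfying `matR ^ 4 • v = v + (2 * form v) • ![1, -2, 4, -4]`. -/
def form (v : Fin 4 → ℤ) : ℤ := 4 * v 0 - 4 * v 1 - v 2 + 2 * v 3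

theorem matR_pow_four_smul (v : Fin 4 → ℤ) :
    matR ^ 4 • v = v + (2 * form v) • ![1, -2, 4, -4] := by
  simp only [pow_succ, pow_zero, one_mul, mul_smul, matR_smul, form]
  ext i
  fin_cases i <;> simp <;> ring

theorem matR_inv_pow_four_smul (v : Fin 4 → ℤ) :
    matR⁻¹ ^ 4 • v = v - (2 * form v) • ![1, -2, 4, -4] := by
  simp only [pow_succ, pow_zero, one_mul, mul_smul, matR_inv_smul, form]
  ext i
  fin_cases i <;> simp <;> ring

theorem form_add_smul (c : ℤ) (v : Fin 4 → ℤ) :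
    form (v + c • ![1, -2, 4, -4]) = form v := by
  simp [form]
  ring

theorem InSlab.add_smul {v : Fin 4 → ℤ} (hv : InSlab v) {c : ℤ} (hc : 0 ≤ c) :
    InSlab (v + c • ![1, -2, 4, -4]) := by
  simp only [InSlab, InCone, matE_smul, matT_inv_smul, Pi.neg_apply, Pi.add_apply,
    Pi.smul_apply, smul_eq_mul, Matrix.cons_val] at hv ⊢
  casesm* _ ∧ _
  and_intros <;> linarith

theorem InSlab.neg_matE_smul {v : Fin 4 → ℤ} (hv : InSlab v) : InSlab (-(matE • v)) := by
  simpa [InSlab, smul_neg, matE_smul_matE_smul] using hv.symm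

theorem InCone.inSlab_matR_smul {v : Fin 4 → ℤ} (hv : InCone v) :
    InSlab (matR • v) ∧ 0 < form (matR • v) := by
  simp only [InSlab, InCone, form, matR_smul, matE_smul,
    matT_inv_smul, Pi.neg_apply, Matrix.cons_val] at hv ⊢
  casesm* _ ∧ _
  and_intros <;> linarith

theorem InCone.inSlab_matR_sq_smul {v : Fin 4 → ℤ} (hv : InCone v) :
    InSlab (-(matR ^ 2 • v)) ∧ 0 < form (-(matR ^ 2 • v)) := by
  simp only [InSlab, InCone, form, pow_succ, pow_zero, one_mul, mul_smul, matR_smul, matE_smul,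
    matT_inv_smul, Pi.neg_apply, Matrix.cons_val] at hv ⊢
  casesm* _ ∧ _
  and_intros <;> linarith

theorem InCone.inSlab_matR_pow_three_smul {v : Fin 4 → ℤ} (hv : InCone v) :
    InSlab (matR ^ 3 • v) ∧ 0 < form (matR ^ 3 • v) := by
  simp only [InSlab, InCone, form, pow_succ, pow_zero, one_mul, mul_smul, matR_smul, matE_smul,
    matT_inv_smul, Pi.neg_apply, Matrix.cons_val] at hv ⊢
  casesm* _ ∧ _
  and_intros <;> linarith

theorem InCone.inSlab_matR_pow_four_smul {v : Fin 4 → ℤ} (hv : InCone v) :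
    InSlab (-(matR ^ 4 • v)) ∧ 0 < form (-(matR ^ 4 • v)) := by
  simp only [InSlab, InCone, form, pow_succ, pow_zero, one_mul, mul_smul, matR_smul, matE_smul,
    matT_inv_smul, Pi.neg_apply, Matrix.cons_val] at hv ⊢
  casesm* _ ∧ _
  and_intros <;> linarith

theorem InCone.inSlab_matR_inv_smul {v : Fin 4 → ℤ} (hv : InCone v) :
    InSlab (-(matR⁻¹ • v)) ∧ form (-(matR⁻¹ • v)) < 0 := by
  simp only [InSlab, InCone, form, matR_inv_smul, matE_smul,
    matT_inv_smul, Pi.neg_apply, Matrix.cons_val] at hv ⊢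
  casesm* _ ∧ _
  and_intros <;> linarith

theorem InCone.inSlab_matR_inv_sq_smul {v : Fin 4 → ℤ} (hv : InCone v) :
    InSlab (matR⁻¹ ^ 2 • v) ∧ form (matR⁻¹ ^ 2 • v) < 0 := by
  simp only [InSlab, InCone, form, pow_succ, pow_zero, one_mul, mul_smul, matR_inv_smul, matE_smul,
    matT_inv_smul, Pi.neg_apply, Matrix.cons_val] at hv ⊢
  casesm* _ ∧ _
  and_intros <;> linarith

theorem InCone.inSlab_matR_inv_pow_three_smul {v : Fin 4 → ℤ} (hv : InCone v) :
    InSlab (-(matR⁻¹ ^ 3 • v)) ∧ form (-(matR⁻¹ ^ 3 • v)) < 0 := by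
  simp only [InSlab, InCone, form, pow_succ, pow_zero, one_mul, mul_smul, matR_inv_smul, matE_smul,
    matT_inv_smul, Pi.neg_apply, Matrix.cons_val] at hv ⊢
  casesm* _ ∧ _
  and_intros <;> linarith

theorem InCone.inSlab_matR_inv_pow_four_smul {v : Fin 4 → ℤ} (hv : InCone v) :
    InSlab (matR⁻¹ ^ 4 • v) ∧ form (matR⁻¹ ^ 4 • v) < 0 := by
  simp only [InSlab, InCone, form, pow_succ, pow_zero, one_mul, mul_smul, matR_inv_smul, matE_smul,
    matT_inv_smul, Pi.neg_apply, Matrix.cons_val] at hv ⊢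
  casesm* _ ∧ _
  and_intros <;> linarith

theorem InCone.inSlab_matR_pow_succ_smul {v : Fin 4 → ℤ} (hv : InCone v) (n : ℕ) :
    (InSlab (matR ^ (n + 1) • v) ∧ 0 < form (matR ^ (n + 1) • v)) ∨
      (InSlab (-(matR ^ (n + 1) • v)) ∧ 0 < form (-(matR ^ (n + 1) • v))) := by
  induction n using Nat.strong_induction_on with
  | _ n ih =>
    match n, ih with
    | 0, _ => simpa using Or.inl hv.inSlab_matR_smul
    | 1, _ => exact Or.inr hv.inSlab_matR_sq_smul
    | 2, _ => exact Or.inl hv.inSlab_matR_pow_three_smul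
    | 3, _ => exact Or.inr hv.inSlab_matR_pow_four_smul
    | n + 4, ih =>
      have hstep {u : Fin 4 → ℤ} (hu : InSlab u ∧ 0 < form u) :
          InSlab (matR ^ 4 • u) ∧ 0 < form (matR ^ 4 • u) := by
        rw [matR_pow_four_smul, form_add_smul]
        exact ⟨hu.1.add_smul (by linarith [hu.2]), hu.2⟩
      rw [show n + 4 + 1 = 4 + (n + 1) by ring, pow_add, mul_smul, ← smul_neg]
      exact (ih n (by lia)).imp hstep hstep

theorem InCone.inSlab_matR_inv_pow_succ_smul {v : Fin 4 → ℤ} (hv : InCone v) (n : ℕ) :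
    (InSlab (matR⁻¹ ^ (n + 1) • v) ∧ form (matR⁻¹ ^ (n + 1) • v) < 0) ∨
      (InSlab (-(matR⁻¹ ^ (n + 1) • v)) ∧ form (-(matR⁻¹ ^ (n + 1) • v)) < 0) := by
  induction n using Nat.strong_induction_on with
  | _ n ih =>
    match n, ih with
    | 0, _ => simpa using Or.inr hv.inSlab_matR_inv_smul
    | 1, _ => exact Or.inl hv.inSlab_matR_inv_sq_smul
    | 2, _ => exact Or.inr hv.inSlab_matR_inv_pow_three_smul
    | 3, _ => exact Or.inl hv.inSlab_matR_inv_pow_four_smul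
    | n + 4, ih =>
      have hstep {u : Fin 4 → ℤ} (hu : InSlab u ∧ form u < 0) :
          InSlab (matR⁻¹ ^ 4 • u) ∧ form (matR⁻¹ ^ 4 • u) < 0 := by
        rw [matR_inv_pow_four_smul, sub_eq_add_neg, ← neg_smul,
          form_add_smul]
        exact ⟨hu.1.add_smul (by linarith [hu.2]), hu.2⟩
      rw [show n + 4 + 1 = 4 + (n + 1) by ring, pow_add, mul_smul, ← smul_neg]
      exact (ih n (by lia)).imp hstep hstep

/-- The ping-pong set of `matT`. -/
def pingT : Set (Fin 4 → ℤ) :=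
  {v | (InCone v ∨ InCone (-v)) ∨ (InCone (matE • v) ∨ InCone (-(matE • v)))}

/-- The ping-pong set of `matR`. -/
def pingR : Set (Fin 4 → ℤ) := {v | InSlab v ∨ InSlab (-v)}

theorem neg_mem_pingT {v : Fin 4 → ℤ} (hv : v ∈ pingT) : -v ∈ pingT := by
  simpa only [pingT, Set.mem_ofPred_eq, smul_neg, neg_neg, or_comm] using hv

theorem matE_smul_mem_pingT {v : Fin 4 → ℤ} (hv : v ∈ pingT) : matE • v ∈ pingT := by
  simpa only [pingT, Set.mem_ofPred_eq, matE_smul_matE_smul] using hv.symm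

theorem neg_mem_pingR {v : Fin 4 → ℤ} (hv : v ∈ pingR) : -v ∈ pingR := by
  simpa only [pingR, Set.mem_ofPred_eq, neg_neg] using hv.symm

theorem matE_smul_mem_pingR {v : Fin 4 → ℤ} (hv : v ∈ pingR) : matE • v ∈ pingR := by
  rcases hv with hv | hv
  · exact Or.inr hv.neg_matE_smul
  · exact Or.inl (by simpa only [smul_neg, neg_neg] using hv.neg_matE_smul)

theorem InCone.matR_zpow_smul_mem_pingR {v : Fin 4 → ℤ} (hv : InCone v) {n : ℤ} (hn : n ≠ 0) :
    matR ^ n • v ∈ pingR := by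
  rcases n with (_ | n) | n
  · exact absurd rfl hn
  · exact (hv.inSlab_matR_pow_succ_smul n).imp And.left And.left
  · rw [zpow_negSucc, ← inv_pow]
    exact (hv.inSlab_matR_inv_pow_succ_smul n).imp And.left And.left

theorem matR_zpow_smul_mem_pingR {n : ℤ} (hn : n ≠ 0) {v : Fin 4 → ℤ} (hv : v ∈ pingT) :
    matR ^ n • v ∈ pingR := by
  have hpm {m : ℤ} (hm : m ≠ 0) {u : Fin 4 → ℤ} (hu : InCone u ∨ InCone (-u)) :
      matR ^ m • u ∈ pingR := by
    rcases hu with hu | hu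
    · exact hu.matR_zpow_smul_mem_pingR hm
    · simpa only [smul_neg, neg_neg] using neg_mem_pingR (hu.matR_zpow_smul_mem_pingR hm)
  rcases hv with hv | hv
  · exact hpm hn hv
  · rw [← matE_smul_matE_smul v, zpow_smul_matE_smul matE_conj_matR]
    exact matE_smul_mem_pingR (hpm (neg_ne_zero.mpr hn) hv)

theorem InSlab.inCone_matT_zpow_smul {v : Fin 4 → ℤ} (hv : InSlab v) {n : ℤ} (hn : n < 0) :
    InCone (matT ^ n • v) := by
  obtain ⟨m, hm, rfl⟩ : ∃ m : ℤ, 0 ≤ m ∧ n = -1 - m := ⟨-1 - n, by lia, by lia⟩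
  have hmul : 0 ≤ m * -v 3 := by
    refine mul_nonneg hm ?_
    have h := hv.1
    simp only [InCone, matT_inv_smul, Matrix.cons_val] at h
    casesm* _ ∧ _
    linarith
  have h := hv.1
  simp only [InCone, matT_inv_smul, matT_zpow_smul, Matrix.cons_val] at h ⊢
  casesm* _ ∧ _
  and_intros <;> linarith

theorem matT_zpow_smul_mem_pingT {n : ℤ} (hn : n ≠ 0) {v : Fin 4 → ℤ} (hv : v ∈ pingR) :
    matT ^ n • v ∈ pingT := by
  have hslab {u : Fin 4 → ℤ} (hu : InSlab u) : matT ^ n • u ∈ pingT := by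
    rcases hn.lt_or_gt with hn | hn
    · exact Or.inl (Or.inl (hu.inCone_matT_zpow_smul hn))
    · have h : matT ^ (-n) • -(matE • u) ∈ pingT :=
        Or.inl (Or.inl (hu.neg_matE_smul.inCone_matT_zpow_smul (by lia)))
      rw [← matE_smul_matE_smul u, zpow_smul_matE_smul matE_conj_matT]
      exact matE_smul_mem_pingT (by simpa only [smul_neg, neg_neg] using neg_mem_pingT h)
  rcases hv with hv | hv
  · exact hslab hv
  · simpa only [smul_neg, neg_neg] using neg_mem_pingT (hslab hv)

theorem disjoint_pingT_pingR : Disjoint pingT pingR := by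
  rw [Set.disjoint_left]
  intro v hT hR
  simp only [pingT, pingR, InSlab, InCone, Set.mem_ofPred_eq, matE_smul, matT_inv_smul,
    Pi.neg_apply, Matrix.cons_val] at hT hR
  rcases hT with (hT | hT) | hT | hT <;> rcases hR with hR | hR <;> casesm* _ ∧ _ <;> linarith

theorem pingT_nonempty : pingT.Nonempty :=
  ⟨![55, 60, 403, -300], Or.inl (Or.inl (by simp [InCone]))⟩

theorem pingR_nonempty : pingR.Nonempty :=
  pingT_nonempty.elim fun v hv => ⟨matR ^ (1 : ℤ) • v, matR_zpow_smul_mem_pingR one_ne_zero hv⟩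

/-- The matrices `T` and `R` freely generate a free group. -/
theorem injective_lift_matT_matR :
    Function.Injective (FreeGroup.lift ![matT, matR] : FreeGroup (Fin 2) →* GL (Fin 4) ℤ) := by
  refine injective_freeGroup_lift_of_zpow_ping_pong _ ![pingT, pingR] ?_ ?_ ?_
  · intro i
    fin_cases i
    · exact pingT_nonempty
    · exact pingR_nonempty
  · intro i j hij
    fin_cases i <;> fin_cases j
    · exact absurd rfl hij
    · exact disjoint_pingT_pingR
    · exact disjoint_pingT_pingR.symm
    · exact absurd rfl hij
  · intro i j hij n hn v hv
    fin_cases i <;> fin_cases j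
    · exact absurd rfl hij
    · exact matT_zpow_smul_mem_pingT hn hv
    · exact matR_zpow_smul_mem_pingR hn hv
    · exact absurd rfl hij

end HypergeometricMonodromy

/-- For `d = 8`, `k = 6`, the hypergeometric matrices `R = T·U` and `T`
generate a free group of rank 2: the homomorphism from the free group on two generators to
`GL(4,ℤ)` sending the first generator to `T` and the second to `R` is injective, and
consequently the subgroup of `GL(4,ℤ)` generated by `R` and `T` is free of rank 2. -/
theorem monodromy_free_of_rank_two_d8_k6
    (R T : GL (Fin 4) ℤ)
    (hR : (R : Matrix (Fin 4) (Fin 4) ℤ) =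
      !![1, 1, 0, 0; 0, -5, -1, 1; 8, 8, 1, 0; 0, -6, -1, 1])
    (hT : (T : Matrix (Fin 4) (Fin 4) ℤ) =
      !![1, 0, 0, 0; 0, 1, 0, 1; 0, 0, 1, 0; 0, 0, 0, 1]) :
    Function.Injective (FreeGroup.lift ![T, R] : FreeGroup (Fin 2) →* GL (Fin 4) ℤ) ∧
    Nonempty (FreeGroup (Fin 2) ≃* (Subgroup.closure ({R, T} : Set (GL (Fin 4) ℤ)))) := by
  obtain rfl : R = HypergeometricMonodromy.matR := Units.ext hR
  obtain rfl : T = HypergeometricMonodromy.matT := Units.ext hT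
  have hinj := HypergeometricMonodromy.injective_lift_matT_matR
  refine ⟨hinj, ⟨(MonoidHom.ofInjective hinj).trans (MulEquiv.subgroupCongr ?_)⟩⟩
  rw [FreeGroup.range_lift_eq_closure, Matrix.range_cons_cons_empty, Set.pair_comm]
end

section
/- Let R and T be the above 4×4 integer matrices with d = 4 and k = 5. Then the group homomorphism from the free group on two generators to GL(4, ℤ) sending the first generator to T and the second generator to R is injective; in particular the subgroup of GL(4, ℤ) generated by R and T is free of rank 2. -/
open scoped MatrixGroups

open scoped Pointwise in
/-- Ping-pong lemma for two infinite cyclic groups: if the nonzero powers of `a` map `Y` into `X`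
and the nonzero powers of `b` map `X` into `Y`, then `a` and `b` are free generators. -/
theorem FreeGroup.injective_lift_pair_of_ping_pong {G α : Type*} [Group G] [MulAction G α]
    (a b : G) (X Y : Set α) (hX : X.Nonempty) (hY : Y.Nonempty) (hXY : Disjoint X Y)
    (ha : ∀ n : ℤ, n ≠ 0 → ∀ y ∈ Y, a ^ n • y ∈ X)
    (hb : ∀ n : ℤ, n ≠ 0 → ∀ x ∈ X, b ^ n • x ∈ Y) :
    Function.Injective (FreeGroup.lift ![a, b]) := by
  have hlift : FreeGroup.lift ![a, b] =
      (Monoid.CoprodI.lift fun i : Fin 2 => FreeGroup.lift fun _ : Unit => ![a, b] i).comp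
        (@freeGroupEquivCoprodI (Fin 2)).toMonoidHom := by
    ext i
    simp
  rw [hlift, MonoidHom.coe_comp]
  refine Function.Injective.comp ?_ (MulEquiv.injective freeGroupEquivCoprodI)
  have hpow : ∀ (c : G) (S S' : Set α), (∀ n : ℤ, n ≠ 0 → ∀ y ∈ S, c ^ n • y ∈ S') →
      ∀ h : FreeGroup Unit, h ≠ 1 → FreeGroup.lift (fun _ => c) h • S ⊆ S' := by
    intro c S S' hc
    refine FreeGroup.freeGroupUnitEquivInt.forall_congr_left.mpr fun n hn => ?_
    change FreeGroup.lift (fun _ => c) (FreeGroup.of () ^ n) • S ⊆ S'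
    rw [map_zpow, FreeGroup.lift_apply_of]
    rintro _ ⟨y, hy, rfl⟩
    refine hc n ?_ y hy
    rintro rfl
    exact hn (by simp [FreeGroup.freeGroupUnitEquivInt])
  refine Monoid.CoprodI.lift_injective_of_ping_pong _ (Or.inr ⟨0, ?_⟩) ![X, Y] ?_ ?_ ?_
  · exact (Cardinal.natCast_lt_aleph0 (n := 3)).le.trans (Cardinal.aleph0_le_mk _)
  · exact Fin.forall_fin_two.2 ⟨hX, hY⟩
  · intro i j hij
    fin_cases i <;> fin_cases j
    · exact absurd rfl hij
    · exact hXY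
    · exact hXY.symm
    · exact absurd rfl hij
  · intro i j hij
    fin_cases i <;> fin_cases j
    · exact absurd rfl hij
    · exact hpow a Y X ha
    · exact hpow b X Y hb
    · exact absurd rfl hij

namespace MonodromyD4K5

open scoped Matrix
open Matrix (mulVec mulVec_mulVec mulVec_neg one_mulVec cons_val)

/-- The inequalities common to all the cones of the ping-pong game. -/
def IsNormalized (x : Fin 4 → ℤ) : Prop := x 0 < 0 ∧ 0 < 3 * x 0 + x 3

/-- The two open cones that attract the powers of `T`. -/
def IsOuter (x : Fin 4 → ℤ) : Prop :=
  IsNormalized x ∧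
    ((x 3 < x 1 ∧ 2 * x 0 + x 3 < x 1 + x 2) ∨ (x 1 < 0 ∧ x 1 + x 2 < 2 * x 0))

/-- The open cone that attracts the powers of `R`. -/
def IsInner (x : Fin 4 → ℤ) : Prop :=
  IsNormalized x ∧ 0 < x 1 ∧ x 1 < x 3 ∧ 2 * x 0 < x 1 + x 2 ∧ x 1 + x 2 < 2 * x 0 + x 3

/-- The vectors satisfying `P` up to sign. -/
def upToSign (P : (Fin 4 → ℤ) → Prop) : Set (Fin 4 → ℤ) := {x | P x ∨ P (-x)}

theorem mulVec_mem_upToSign {P Q : (Fin 4 → ℤ) → Prop} {A : Matrix (Fin 4) (Fin 4) ℤ}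
    (h : ∀ x, P x → A *ᵥ x ∈ upToSign Q) : ∀ x ∈ upToSign P, A *ᵥ x ∈ upToSign Q := by
  rintro x (hx | hx)
  · exact h x hx
  · have := h _ hx
    rw [mulVec_neg] at this
    simpa [upToSign, or_comm] using this

theorem upToSign_mono {P Q : (Fin 4 → ℤ) → Prop} (h : ∀ x, P x → Q x) :
    upToSign P ⊆ upToSign Q :=
  fun _ => Or.imp (h _) (h _)

theorem disjoint_outer_inner : Disjoint (upToSign IsOuter) (upToSign IsInner) := by
  rw [Set.disjoint_left]
  simp only [upToSign, IsOuter, IsInner, IsNormalized, Set.mem_ofPred_eq, Pi.neg_apply]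
  omega

/-- The functional defining the transvection `-R ^ 3`. -/
def cubeFunctional (x : Fin 4 → ℤ) : ℤ := 2 * x 0 - 4 * x 1 - x 2 + 2 * x 3

/-- The matrix `R`. -/
def matR : Matrix (Fin 4) (Fin 4) ℤ := !![1, 1, 0, 0; 0, -4, -1, 1; 4, 4, 1, 0; 0, -5, -1, 1]

/-- The inverse of `matR`. -/
def matRInv : Matrix (Fin 4) (Fin 4) ℤ :=
  !![1, -1, 0, 1; 0, 1, 0, -1; -4, 0, 1, 0; -4, 5, 1, -4]

/-- The matrix `T ^ n`. -/
def matT (n : ℤ) : Matrix (Fin 4) (Fin 4) ℤ :=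
  !![1, 0, 0, 0; 0, 1, 0, n; 0, 0, 1, 0; 0, 0, 0, 1]

theorem matR_mulVec (x : Fin 4 → ℤ) : matR *ᵥ x =
    ![x 0 + x 1, -4 * x 1 - x 2 + x 3, 4 * x 0 + 4 * x 1 + x 2, -5 * x 1 - x 2 + x 3] := by
  ext i
  fin_cases i <;> simp [matR, mulVec, dotProduct, Fin.sum_univ_four] <;> ring

theorem matRInv_mulVec (x : Fin 4 → ℤ) : matRInv *ᵥ x =
    ![x 0 - x 1 + x 3, x 1 - x 3, -4 * x 0 + x 2, -4 * x 0 + 5 * x 1 + x 2 - 4 * x 3] := by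
  ext i
  fin_cases i <;> simp [matRInv, mulVec, dotProduct, Fin.sum_univ_four] <;> ring

theorem matT_mulVec (n : ℤ) (x : Fin 4 → ℤ) :
    matT n *ᵥ x = ![x 0, x 1 + n * x 3, x 2, x 3] := by
  ext i
  fin_cases i <;> simp [matT, mulVec, dotProduct, Fin.sum_univ_four]

theorem matR_mul_matRInv : matR * matRInv = 1 := by decide

theorem matT_mul (m n : ℤ) : matT m * matT n = matT (m + n) := by
  ext i j
  fin_cases i <;> fin_cases j <;> simp [matT, Matrix.mul_apply, Fin.sum_univ_four, add_comm]

theorem matT_mulVec_mem {n : ℤ} (hn : n ≠ 0) :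
    ∀ x ∈ upToSign IsInner, matT n *ᵥ x ∈ upToSign IsOuter := by
  refine mulVec_mem_upToSign fun x hx => Or.inl ?_
  rw [matT_mulVec]
  obtain ⟨⟨h0, h3⟩, h1, h13, h2, h23⟩ := hx
  refine ⟨⟨h0, h3⟩, ?_⟩
  rcases hn.lt_or_gt with hn | hn
  · right
    have : n * x 3 ≤ -x 3 := by nlinarith
    simp
    omega
  · left
    have : x 3 ≤ n * x 3 := by nlinarith
    simp
    omega

/-- If the first three iterates of `A` send the outer cones into the part of the inner cone where
`s * cubeFunctional` is positive and `A ^ 3` preserves this part, then all iterates do. -/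
theorem pow_mulVec_mem (A : Matrix (Fin 4) (Fin 4) ℤ) (s : ℤ)
    (h₁ : ∀ x, IsOuter x → A *ᵥ x ∈ upToSign fun y => IsInner y ∧ 0 < s * cubeFunctional y)
    (h₂ : ∀ x, IsOuter x →
      A *ᵥ A *ᵥ x ∈ upToSign fun y => IsInner y ∧ 0 < s * cubeFunctional y)
    (h₃ : ∀ x, IsOuter x →
      A *ᵥ A *ᵥ A *ᵥ x ∈ upToSign fun y => IsInner y ∧ 0 < s * cubeFunctional y)
    (hstep : ∀ x, IsInner x ∧ 0 < s * cubeFunctional x →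
      A *ᵥ A *ᵥ A *ᵥ x ∈ upToSign fun y => IsInner y ∧ 0 < s * cubeFunctional y)
    (k : ℕ) : ∀ x ∈ upToSign IsOuter,
      A ^ (k + 1) *ᵥ x ∈ upToSign fun y => IsInner y ∧ 0 < s * cubeFunctional y := by
  simp only [mulVec_mulVec] at h₂ h₃ hstep
  match k with
  | 0 => simpa using mulVec_mem_upToSign h₁
  | 1 => simpa [pow_succ] using mulVec_mem_upToSign h₂
  | 2 => simpa [pow_succ, mul_assoc] using mulVec_mem_upToSign h₃
  | k + 3 =>
    intro x hx
    have hpow : A ^ (k + 3 + 1) = A * (A * A) * A ^ (k + 1) := by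
      rw [show k + 3 + 1 = 3 + (k + 1) by omega, pow_add, pow_succ', pow_two]
    rw [hpow, ← mulVec_mulVec]
    exact mulVec_mem_upToSign hstep _ (pow_mulVec_mem A s h₁ (by simpa using h₂)
      (by simpa using h₃) (by simpa using hstep) k x hx)

theorem matR_pow_mulVec_mem (k : ℕ) :
    ∀ x ∈ upToSign IsOuter, matR ^ (k + 1) *ᵥ x ∈ upToSign IsInner := by
  intro x hx
  refine upToSign_mono (fun _ => And.left) (pow_mulVec_mem matR (-1) ?_ ?_ ?_ ?_ k x hx) <;>
  · simp only [matR_mulVec, upToSign, IsOuter, IsInner, IsNormalized, cubeFunctional,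
      Set.mem_ofPred_eq, Pi.neg_apply, cons_val]
    intro x
    omega

theorem matRInv_pow_mulVec_mem (k : ℕ) :
    ∀ x ∈ upToSign IsOuter, matRInv ^ (k + 1) *ᵥ x ∈ upToSign IsInner := by
  intro x hx
  refine upToSign_mono (fun _ => And.left) (pow_mulVec_mem matRInv 1 ?_ ?_ ?_ ?_ k x hx) <;>
  · simp only [matRInv_mulVec, upToSign, IsOuter, IsInner, IsNormalized, cubeFunctional,
      Set.mem_ofPred_eq, Pi.neg_apply, cons_val]
    intro x
    omega

theorem coe_zpow_eq_matT (T : GL (Fin 4) ℤ) (hT : (T : Matrix (Fin 4) (Fin 4) ℤ) = matT 1)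
    (n : ℤ) : ((T ^ n : GL (Fin 4) ℤ) : Matrix (Fin 4) (Fin 4) ℤ) = matT n := by
  have hone : matT 0 = 1 := by decide
  have hinv : ((T⁻¹ : GL (Fin 4) ℤ) : Matrix (Fin 4) (Fin 4) ℤ) = matT (-1) :=
    Units.inv_eq_of_mul_eq_one_right (by rw [hT, matT_mul, ← hone]; rfl)
  induction n with
  | zero => simp [hone]
  | succ n ih => rw [zpow_add_one, Units.val_mul, ih, hT, matT_mul]
  | pred n ih => rw [zpow_sub_one, Units.val_mul, ih, hinv, matT_mul]; rfl

theorem coe_zpow_mulVec_mem (R : GL (Fin 4) ℤ) (hR : (R : Matrix (Fin 4) (Fin 4) ℤ) = matR)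
    {n : ℤ} (hn : n ≠ 0) :
    ∀ x ∈ upToSign IsOuter,
      ((R ^ n : GL (Fin 4) ℤ) : Matrix (Fin 4) (Fin 4) ℤ) *ᵥ x ∈ upToSign IsInner := by
  have hinv : ((R⁻¹ : GL (Fin 4) ℤ) : Matrix (Fin 4) (Fin 4) ℤ) = matRInv :=
    Units.inv_eq_of_mul_eq_one_right (by rw [hR, matR_mul_matRInv])
  obtain ⟨k, rfl | rfl⟩ := n.eq_nat_or_neg
  · obtain ⟨k, rfl⟩ := Nat.exists_eq_succ_of_ne_zero (n := k) (by simpa using hn)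
    rw [zpow_natCast, Units.val_pow_eq_pow_val, hR]
    exact matR_pow_mulVec_mem k
  · obtain ⟨k, rfl⟩ := Nat.exists_eq_succ_of_ne_zero (n := k) (by simpa using hn)
    rw [zpow_neg, ← inv_zpow, zpow_natCast, Units.val_pow_eq_pow_val, hinv]
    exact matRInv_pow_mulVec_mem k

/-- The action of `GL (Fin 4) ℤ` on column vectors. -/
abbrev mulVecAction : MulAction (GL (Fin 4) ℤ) (Fin 4 → ℤ) where
  smul g x := (g : Matrix (Fin 4) (Fin 4) ℤ) *ᵥ x
  one_smul x := one_mulVec x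
  mul_smul g h x := (mulVec_mulVec x g.1 h.1).symm

end MonodromyD4K5

open MonodromyD4K5 in
/-- For `d = 4`, `k = 5`, the hypergeometric matrices `R = T·U` and `T`
generate a free group of rank 2: the homomorphism from the free group on two generators to
`GL(4,ℤ)` sending the first generator to `T` and the second to `R` is injective, and
consequently the subgroup of `GL(4,ℤ)` generated by `R` and `T` is free of rank 2. -/
theorem monodromy_free_of_rank_two_d4_k5
    (R T : GL (Fin 4) ℤ)
    (hR : (R : Matrix (Fin 4) (Fin 4) ℤ) =
      !![1, 1, 0, 0; 0, -4, -1, 1; 4, 4, 1, 0; 0, -5, -1, 1])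
    (hT : (T : Matrix (Fin 4) (Fin 4) ℤ) =
      !![1, 0, 0, 0; 0, 1, 0, 1; 0, 0, 1, 0; 0, 0, 0, 1]) :
    Function.Injective (FreeGroup.lift ![T, R] : FreeGroup (Fin 2) →* GL (Fin 4) ℤ) ∧
    Nonempty (FreeGroup (Fin 2) ≃* (Subgroup.closure ({R, T} : Set (GL (Fin 4) ℤ)))) := by
  have hinj : Function.Injective (FreeGroup.lift ![T, R]) := by
    let := mulVecAction
    refine FreeGroup.injective_lift_pair_of_ping_pong T R (upToSign IsOuter) (upToSign IsInner)
      ⟨![-1, 5, 0, 4], Or.inl ?_⟩ ⟨![-1, 2, -2, 4], Or.inl ?_⟩ disjoint_outer_inner ?_ ?_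
    · simp [IsOuter, IsNormalized]
    · simp [IsInner, IsNormalized]
    · intro n hn x hx
      change ((T ^ n : GL (Fin 4) ℤ) : Matrix (Fin 4) (Fin 4) ℤ).mulVec x ∈ _
      rw [coe_zpow_eq_matT T hT]
      exact matT_mulVec_mem hn x hx
    · exact fun n hn x hx => coe_zpow_mulVec_mem R hR hn x hx
  refine ⟨hinj, ⟨(MonoidHom.ofInjective hinj).trans (MulEquiv.subgroupCongr ?_)⟩⟩
  rw [FreeGroup.range_lift_eq_closure, Matrix.range_cons_cons_empty, Set.pair_comm]
end
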